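/- arXiv:1507.04359 — 2 statements merged into one kernel-verified Lean document; each statement's English description precedes it below -/
import Mathlib

section
/- Let Γ be an austere finite simplicial graph with vertices v_1, …, v_n, n > 1. For each function φ : {1, …, n} → (ℤ/2ℤ)^n satisfying (i) the k-th coordinate of φ(k) is 0 for all k, and (ii) the j-th coordinate of φ(k) is 0 whenever v_k and v_j are adjacent in Γ, there is a unique automorphism Φ_φ of Aut(A_Γ) with Φ_φ(γ_k) = γ_k · ι^{φ(k)} and Φ_φ(ι_k) = ι_k for all k, where γ_k is conjugation by v_k, ι_k is the inversion of v_k, and ι^{φ(k)} denotes the product of the inversions ι_j over the coordinates j where φ(k) is nonzero. Moreover each Φ_φ is an involution, Φ_φ is not an inner automorphism of Aut(A_Γ) when φ is not identically zero, and the map sending φ to the class of Φ_φ in Out(Aut(A_Γ)) is injective. -/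
noncomputable section

/-- The subgroup of inner automorphisms inside `MulAut G`. -/
def Inn (G : Type) [Group G] : Subgroup (MulAut G) :=
  (MulAut.conj : G →* MulAut G).range

instance Inn.normal (G : Type) [Group G] : (Inn G).Normal := by
  constructor
  rintro x ⟨g, rfl⟩ φ
  refine ⟨φ g, ?_⟩
  ext h
  simp [MulAut.mul_apply, MulAut.conj_apply, map_mul, map_inv]

/-- The outer automorphism group of `G`. -/
abbrev Out (G : Type) [Group G] := MulAut G ⧸ Inn G

/-- The set of commutator relators defining the RAAG of a graph. -/
def raagRels {V : Type} (G : SimpleGraph V) : Set (FreeGroup V) :=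
  {r | ∃ u v : V, G.Adj u v ∧
    r = FreeGroup.of u * FreeGroup.of v * (FreeGroup.of u)⁻¹ * (FreeGroup.of v)⁻¹}

/-- The right-angled Artin group of a graph. -/
abbrev RAAG {V : Type} (G : SimpleGraph V) := PresentedGroup (raagRels G)

/-- The standard generator of `RAAG G` corresponding to a vertex. -/
def gen {V : Type} (G : SimpleGraph V) (v : V) : RAAG G := PresentedGroup.of v

/-- The star of a vertex: the vertex together with its neighbours. -/
def star {V : Type} (G : SimpleGraph V) (v : V) : Set V := insert v (G.neighborSet v)

/-- `u` dominates `v` if `lk(v) ⊆ st(u)`. -/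
def Dominates {V : Type} (G : SimpleGraph V) (u v : V) : Prop :=
  G.neighborSet v ⊆ star G u

/-- A graph has trivial automorphism group. -/
def TrivialAut {V : Type} (G : SimpleGraph V) : Prop := ∀ e : G ≃g G, ∀ v, e v = v

/-- A graph is focused at a vertex `c`. -/
def Focused {V : Type} (G : SimpleGraph V) (c : V) : Prop :=
  (∀ u v : V, u ≠ v → Dominates G u v → u = c) ∧
  ∀ v : V, v ≠ c → (G.induce (star G v)ᶜ).Connected

/-- A graph is austere. -/
def Austere {V : Type} (G : SimpleGraph V) : Prop :=
  TrivialAut G ∧ (∀ u v : V, u ≠ v → ¬Dominates G u v) ∧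
  ∀ v : V, (G.induce (star G v)ᶜ).Connected

/-- `P` is (the vertex set of) a connected component of the induced subgraph on `s`. -/
def IsCompOf {V : Type} (G : SimpleGraph V) (s : Set V) (P : Set V) : Prop :=
  ∃ x : s, P = Subtype.val '' {y : s | (G.induce s).Reachable x y}

/-- `φ` is the inversion at the vertex `v`. -/
def IsInversion {V : Type} (G : SimpleGraph V) (φ : MulAut (RAAG G)) (v : V) : Prop :=
  φ (gen G v) = (gen G v)⁻¹ ∧ ∀ w : V, w ≠ v → φ (gen G w) = gen G w

/-- `φ` is the transvection `τ_{uv}` (`v ↦ uv`). -/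
def IsTransvection {V : Type} (G : SimpleGraph V) (φ : MulAut (RAAG G)) (u v : V) : Prop :=
  u ≠ v ∧ Dominates G u v ∧ φ (gen G v) = gen G u * gen G v ∧
    ∀ w : V, w ≠ v → φ (gen G w) = gen G w

/-- `φ` is the partial conjugation `χ_{v,P}`. -/
def IsPartialConj {V : Type} (G : SimpleGraph V) (φ : MulAut (RAAG G)) (v : V) (P : Set V) :
    Prop :=
  IsCompOf G (star G v)ᶜ P ∧ (∀ u ∈ P, φ (gen G u) = gen G v * gen G u * (gen G v)⁻¹) ∧
    ∀ w : V, w ∉ P → φ (gen G w) = gen G w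

/-- The subgroup `I_Γ` of `Aut(A_Γ)` generated by the inversions. -/
def InvSubgroup {V : Type} (G : SimpleGraph V) : Subgroup (MulAut (RAAG G)) :=
  Subgroup.closure {φ | ∃ v, IsInversion G φ v}

/-- The subgroup `PCT` of `Aut(A_Γ)` generated by transvections and partial conjugations. -/
def PCT {V : Type} (G : SimpleGraph V) : Subgroup (MulAut (RAAG G)) :=
  Subgroup.closure {φ | (∃ u v, IsTransvection G φ u v) ∨ ∃ v P, IsPartialConj G φ v P}

/-- The number `l` of vertices dominated by but not adjacent to `c`. -/
def lInv {V : Type} (G : SimpleGraph V) (c : V) : ℕ :=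
  Nat.card {v : V | v ≠ c ∧ Dominates G c v ∧ ¬G.Adj c v}

/-- The number `m` of vertices (other than `c`) dominated by `c`. -/
def mInv {V : Type} (G : SimpleGraph V) (c : V) : ℕ :=
  Nat.card {v : V | v ≠ c ∧ Dominates G c v}

/-- The number `k` of connected components of `Γ \ st(c)`. -/
def kInv {V : Type} (G : SimpleGraph V) (c : V) : ℕ :=
  Nat.card ((G.induce (star G c)ᶜ).ConnectedComponent)

/-- `GL_n(ℤ)`. -/
abbrev GLZ (n : ℕ) := Matrix.GeneralLinearGroup (Fin n) ℤ

/-- `PGL_n(ℤ)`, the quotient of `GL_n(ℤ)` by its centre `{±I}`. -/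
abbrev PGLZ (n : ℕ) := GLZ n ⧸ Subgroup.center (GLZ n)

/-- The principal level 2 congruence subgroup `Λ_l[2]` of `GL_l(ℤ)`. -/
def congr2 (l : ℕ) : Subgroup (GLZ l) :=
  (Matrix.GeneralLinearGroup.map (Int.castRingHom (ZMod 2)) :
    GLZ l →* Matrix.GeneralLinearGroup (Fin l) (ZMod 2)).ker

/-- The matrix `(1 1 / 0 -1)`. -/
def Bmat : Matrix (Fin 2) (Fin 2) ℤ := !![1, 1; 0, -1]

/-- A block-diagonal `2l × 2l` matrix whose `i`th `2 × 2` diagonal block is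
`Bmat` if `ε i` and the identity otherwise. -/
def Lmat (l : ℕ) (ε : Fin l → Bool) : Matrix (Fin l × Fin 2) (Fin l × Fin 2) ℤ :=
  fun a b =>
    if a.1 = b.1 then (if ε a.1 then Bmat a.2 b.2 else (1 : Matrix (Fin 2) (Fin 2) ℤ) a.2 b.2)
    else 0

/-- `GL_{2l}(ℤ)`, with rows and columns indexed by `Fin l × Fin 2`. -/
abbrev GL2l (l : ℕ) := Matrix.GeneralLinearGroup (Fin l × Fin 2) ℤ

/-- The subgroup `𝓛 ≤ GL_{2l}(ℤ)`. -/
def scriptL (l : ℕ) : Subgroup (GL2l l) :=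
  Subgroup.closure {M : GL2l l |
    ∃ ε : Fin l → Bool, (M : Matrix (Fin l × Fin 2) (Fin l × Fin 2) ℤ) = Lmat l ε}

/-- The index type realizing the block decomposition `d = 2l + p + q`. -/
abbrev BIdx (l p q : ℕ) := (Fin l × Fin 2) ⊕ (Fin p ⊕ Fin q)

/-- The block-diagonal matrix `Diag(D₁, D₂, ε·I_q)` with `D₁ ∈ 𝓛` given by `ε1`,
`D₂` diagonal with entries `d2`, and `ε = e`. -/
def Dmat (l p q : ℕ) (ε1 : Fin l → Bool) (d2 : Fin p → ℤˣ) (e : ℤˣ) :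
    Matrix (BIdx l p q) (BIdx l p q) ℤ := fun a b =>
  match a, b with
  | Sum.inl a, Sum.inl b => Lmat l ε1 a b
  | Sum.inr (Sum.inl i), Sum.inr (Sum.inl j) => if i = j then (d2 i : ℤ) else 0
  | Sum.inr (Sum.inr i), Sum.inr (Sum.inr j) => if i = j then (e : ℤ) else 0
  | _, _ => 0

/-- The subgroup `D ≤ GL_d(ℤ)` generated by `−I_d` and the block-diagonal matrices
`Diag(D₁, D₂, ε·I_q)`. -/
def DSub (l p q : ℕ) : Subgroup (Matrix.GeneralLinearGroup (BIdx l p q) ℤ) :=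
  Subgroup.closure
    ({M | (M : Matrix (BIdx l p q) (BIdx l p q) ℤ) = -1} ∪
     {M | ∃ ε1 d2 e, (M : Matrix (BIdx l p q) (BIdx l p q) ℤ) = Dmat l p q ε1 d2 e})

/-- The condition on the function `φ : {1, …, n} → (ℤ/2)^n`. -/
def cond15 {V : Type} (G : SimpleGraph V) {n : ℕ} (v : Fin n ≃ V)
    (φ : Fin n → Fin n → ZMod 2) : Prop :=
  (∀ k, φ k k = 0) ∧ ∀ k j, G.Adj (v k) (v j) → φ k j = 0

/-- `Φ` acts as `γ_k ↦ γ_k · ι^{φ(k)}` and `ι_k ↦ ι_k`. -/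
def prop15 {V : Type} (G : SimpleGraph V) {n : ℕ} (v : Fin n ≃ V)
    (ι : Fin n → MulAut (RAAG G)) (φ : Fin n → Fin n → ZMod 2)
    (Φ : MulAut (MulAut (RAAG G))) : Prop :=
  ∀ k, Φ (MulAut.conj (gen G (v k))) =
      MulAut.conj (gen G (v k)) * (List.ofFn fun j => ι j ^ (φ k j).val).prod ∧
    Φ (ι k) = ι k

namespace Raag

variable {V : Type} {G : SimpleGraph V}

/-! ### Homomorphisms out of a right-angled Artin group -/

lemma gen_commute {u v : V} (h : G.Adj u v) : Commute (gen G u) (gen G v) := by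
  have : (PresentedGroup.mk (raagRels G)) (FreeGroup.of u * FreeGroup.of v *
      (FreeGroup.of u)⁻¹ * (FreeGroup.of v)⁻¹) = 1 :=
    PresentedGroup.one_of_mem ⟨u, v, h, rfl⟩
  simp only [map_mul, map_inv] at this
  exact mul_inv_eq_iff_eq_mul.1 (mul_inv_eq_one.1 this)

/-- The homomorphism out of `RAAG G` induced by a map on generators respecting commutation. -/
def lift {H : Type*} [Group H] (φ : V → H) (h : ∀ u v, G.Adj u v → Commute (φ u) (φ v)) :
    RAAG G →* H :=
  PresentedGroup.toGroup (f := φ) (by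
    rintro r ⟨u, v, huv, rfl⟩
    simp only [map_mul, map_inv, FreeGroup.lift_apply_of]
    rw [(h u v huv).eq]
    group)

@[simp] lemma lift_gen {H : Type*} [Group H] (φ : V → H)
    (h : ∀ u v, G.Adj u v → Commute (φ u) (φ v)) (v : V) : lift φ h (gen G v) = φ v :=
  PresentedGroup.toGroup.of _

lemma hom_ext {H : Type*} [Group H] {f g : RAAG G →* H} (h : ∀ v, f (gen G v) = g (gen G v)) :
    f = g :=
  PresentedGroup.ext h

@[elab_as_elim]
lemma gen_induction {p : RAAG G → Prop} (h1 : p 1) (hg : ∀ v, p (gen G v))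
    (hm : ∀ a b, p a → p b → p (a * b)) (hi : ∀ a, p a → p a⁻¹) (g : RAAG G) : p g := by
  let H : Subgroup (RAAG G) :=
    { carrier := {g | p g}, mul_mem' := fun ha hb => hm _ _ ha hb, one_mem' := h1,
      inv_mem' := fun ha => hi _ ha }
  exact PresentedGroup.generated_by (raagRels G) H hg g

open Classical in
/-- The retraction of `RAAG G` onto the subgroup generated by a set of vertices. -/
def ret (G : SimpleGraph V) (S : Set V) : RAAG G →* RAAG G :=
  lift (fun w => if w ∈ S then gen G w else 1) (by
    intro u v huv
    split_ifs <;> simp [gen_commute huv])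

lemma ret_gen_of_mem {S : Set V} {v : V} (h : v ∈ S) : ret G S (gen G v) = gen G v := by
  simp [ret, h]

lemma ret_gen_of_notMem {S : Set V} {v : V} (h : v ∉ S) : ret G S (gen G v) = 1 := by
  simp [ret, h]

lemma ret_ret (S T : Set V) (g : RAAG G) : ret G S (ret G T g) = ret G (S ∩ T) g := by
  have : (ret G S).comp (ret G T) = ret G (S ∩ T) := hom_ext fun v => by
    by_cases hT : v ∈ T <;> by_cases hS : v ∈ S <;> simp [ret, hS, hT]
  exact DFunLike.congr_fun this g

lemma ret_comm (S T : Set V) (g : RAAG G) : ret G S (ret G T g) = ret G T (ret G S g) := by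
  rw [ret_ret, ret_ret, Set.inter_comm]

lemma ret_univ (g : RAAG G) : ret G Set.univ g = g := by
  have : ret G Set.univ = MonoidHom.id _ := hom_ext fun v => by simp [ret]
  exact DFunLike.congr_fun this g

lemma ret_idem (S : Set V) (g : RAAG G) : ret G S (ret G S g) = ret G S g := by
  rw [ret_ret, Set.inter_self]

lemma ret_eq_of_subset {S T : Set V} (h : S ⊆ T) {g : RAAG G} (hg : ret G S g = g) :
    ret G T g = g := by
  rw [← hg, ret_ret, Set.inter_eq_right.2 h]

lemma ret_inter_eq {S T : Set V} {g : RAAG G} (hS : ret G S g = g) (hT : ret G T g = g) :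
    ret G (S ∩ T) g = g := by
  rw [← ret_ret, hT, hS]

lemma mem_star {v w : V} : w ∈ _root_.star G v ↔ w = v ∨ G.Adj v w := by
  simp [_root_.star]

lemma commute_ret {S : Set V} {v : V} (h : S ⊆ _root_.star G v) (g : RAAG G) :
    Commute (ret G S g) (gen G v) := by
  have : (MulAut.conj (gen G v)).toMonoidHom.comp (ret G S) = ret G S := hom_ext fun w => by
    by_cases hw : w ∈ S
    · have hc : Commute (gen G v) (gen G w) := by
        rcases mem_star.1 (h hw) with rfl | h'
        · exact Commute.refl _
        · exact gen_commute h'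
      simp [ret_gen_of_mem hw, hc.eq]
    · simp [ret_gen_of_notMem hw]
  have := DFunLike.congr_fun this g
  simp only [MonoidHom.comp_apply, MulEquiv.coe_toMonoidHom, MulAut.conj_apply] at this
  exact (mul_inv_eq_iff_eq_mul.1 this).symm

lemma commute_of_ret_eq {S : Set V} {v : V} (h : S ⊆ _root_.star G v) {g : RAAG G}
    (hg : ret G S g = g) : Commute g (gen G v) :=
  hg ▸ commute_ret h g

open Classical in
/-- The exponent sum of a vertex, as a homomorphism. -/
def expHom (G : SimpleGraph V) (v : V) : RAAG G →* Multiplicative ℤ :=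
  lift (fun w => Multiplicative.ofAdd (if w = v then 1 else 0)) (fun _ _ _ => Commute.all _ _)

/-- The exponent sum of a vertex. -/
def deg (v : V) (g : RAAG G) : ℤ := (expHom G v g).toAdd

@[simp] lemma deg_one (v : V) : deg v (1 : RAAG G) = 0 := by simp [deg]

@[simp] lemma deg_mul (v : V) (g h : RAAG G) : deg v (g * h) = deg v g + deg v h := by simp [deg]

@[simp] lemma deg_inv (v : V) (g : RAAG G) : deg v g⁻¹ = -deg v g := by simp [deg]

@[simp] lemma deg_pow (v : V) (g : RAAG G) (k : ℕ) : deg v (g ^ k) = k * deg v g := by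
  simp [deg]

@[simp] lemma deg_zpow (v : V) (g : RAAG G) (k : ℤ) : deg v (g ^ k) = k * deg v g := by
  simp [deg]

open Classical in
lemma deg_gen (v w : V) : deg v (gen G w) = if w = v then 1 else 0 := by simp [deg, expHom]

@[simp] lemma deg_gen_self (v : V) : deg v (gen G v) = 1 := by simp [deg_gen]

lemma deg_gen_of_ne {v w : V} (h : w ≠ v) : deg v (gen G w) = 0 := by simp [deg_gen, h]

lemma deg_ret_of_mem {S : Set V} {v : V} (h : v ∈ S) (g : RAAG G) :
    deg v (ret G S g) = deg v g := by
  have : (expHom G v).comp (ret G S) = expHom G v := hom_ext fun w => by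
    by_cases hw : w ∈ S
    · simp [ret_gen_of_mem hw]
    · have : w ≠ v := fun e => hw (e ▸ h)
      simp [ret_gen_of_notMem hw, expHom, this]
  exact congrArg Multiplicative.toAdd (DFunLike.congr_fun this g)

lemma deg_ret_of_notMem {S : Set V} {v : V} (h : v ∉ S) (g : RAAG G) :
    deg v (ret G S g) = 0 := by
  have : (expHom G v).comp (ret G S) = 1 := hom_ext fun w => by
    by_cases hw : w ∈ S
    · have : w ≠ v := fun e => h (e ▸ hw)
      simp [ret_gen_of_mem hw, expHom, this]
    · simp [ret_gen_of_notMem hw]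
  exact congrArg Multiplicative.toAdd (DFunLike.congr_fun this g)

lemma ret_singleton (v : V) (g : RAAG G) : ret G {v} g = gen G v ^ deg v g := by
  have : ret G {v} = (zpowersHom _ (gen G v)).comp (expHom G v) := hom_ext fun w => by
    by_cases hw : w = v
    · subst hw; simp [ret_gen_of_mem, expHom]
    · simp [ret_gen_of_notMem, expHom, hw]
  exact DFunLike.congr_fun this g

lemma ret_star (v : V) (g : RAAG G) :
    ret G (_root_.star G v) g = gen G v ^ deg v g * ret G (G.neighborSet v) g := by
  have hc : ∀ (k : ℤ) (h : RAAG G), Commute (ret G (G.neighborSet v) h) (gen G v ^ k) :=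
    fun k h => (commute_ret (fun w hw => mem_star.2 (Or.inr hw)) h).zpow_right k
  induction g using gen_induction with
  | h1 => simp
  | hg w =>
    by_cases hw : w = v
    · subst hw
      rw [ret_gen_of_mem (mem_star.2 (Or.inl rfl)), ret_gen_of_notMem (by simp)]
      simp
    · by_cases ha : G.Adj v w
      · rw [ret_gen_of_mem (mem_star.2 (Or.inr ha)), ret_gen_of_mem (S := G.neighborSet v) ha,
          deg_gen_of_ne hw]
        simp
      · rw [ret_gen_of_notMem (by simp [mem_star, hw, ha]),
          ret_gen_of_notMem (S := G.neighborSet v) ha, deg_gen_of_ne hw]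
        simp
  | hm a b ha hb =>
    rw [map_mul, map_mul, ha, hb, deg_mul, zpow_add, mul_assoc, mul_assoc,
      ← mul_assoc (ret G (G.neighborSet v) a), (hc _ a).eq, mul_assoc]
  | hi a ha =>
    rw [map_inv, map_inv, ha, deg_inv, zpow_neg, mul_inv_rev, ← mul_inv_rev, (hc _ a).symm.eq,
      mul_inv_rev]

/-- An intersection-closed family of sets of vertices containing all `{t}ᶜ` with `t ∉ S`
contains `S`. -/
lemma inter_closed [Finite V] {P : Set V → Prop} (h0 : P Set.univ)
    (hi : ∀ R T, P R → P T → P (R ∩ T)) (S : Set V) (h : ∀ t, t ∉ S → P {t}ᶜ) : P S := by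
  have key : ∀ T : Set V, T.Finite → T ⊆ Sᶜ → P Tᶜ := by
    intro T hT
    induction T, hT using Set.Finite.induction_on with
    | empty => intro _; simpa using h0
    | @insert a s _ _ ih =>
      intro hs
      have : (insert a s)ᶜ = {a}ᶜ ∩ sᶜ := by ext x; simp
      rw [this]
      exact hi _ _ (h a (hs (Set.mem_insert _ _))) (ih ((Set.subset_insert _ _).trans hs))
  simpa using key Sᶜ (Set.toFinite _) subset_rfl

/-! ### The splitting over the link of a vertex -/

section Splitting

variable (G) (u : V)

/-- The cosets of the subgroup generated by the link of `u`. -/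
abbrev LinkCoset : Type := RAAG G ⧸ (ret G (G.neighborSet u)).range

/-- The action of `RAAG G` on the free group over the cosets of the link subgroup of `u`. -/
def act : RAAG G →* MulAut (FreeGroup (LinkCoset G u)) where
  toFun a := FreeGroup.freeGroupCongr (MulAction.toPerm a)
  map_one' := by
    ext x
    have : ⇑(MulAction.toPerm (1 : RAAG G) : Equiv.Perm (LinkCoset G u)) = id := by
      ext y
      simp
    simp only [FreeGroup.freeGroupCongr, MulAut.one_apply, MulEquiv.coe_mk, Equiv.coe_fn_mk]
    rw [this, FreeGroup.map.id]
  map_mul' a b := by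
    ext x
    simp only [FreeGroup.freeGroupCongr, MulAut.mul_apply, MulEquiv.coe_mk, Equiv.coe_fn_mk]
    rw [FreeGroup.map.comp]
    congr 2
    ext y
    simp [mul_smul]

variable {G}

@[simp] lemma act_of (a : RAAG G) (t : LinkCoset G u) :
    act G u a (FreeGroup.of t) = FreeGroup.of (a • t) := by
  simp [act, FreeGroup.freeGroupCongr]

variable (G)

open Classical in
/-- The embedding of `RAAG G` in a semidirect product with a free group, in which `u` becomes a
free generator. -/
def split : RAAG G →* FreeGroup (LinkCoset G u) ⋊[act G u] RAAG G :=
  lift (fun w => if w = u then SemidirectProduct.inl (FreeGroup.of (QuotientGroup.mk 1))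
      else SemidirectProduct.inr (gen G w)) (by
    have key : ∀ w, G.Adj u w → Commute
        (SemidirectProduct.inl (FreeGroup.of (QuotientGroup.mk 1)) :
          FreeGroup (LinkCoset G u) ⋊[act G u] RAAG G) (SemidirectProduct.inr (gen G w)) := by
      intro w hw
      have : (gen G w • (QuotientGroup.mk 1 : LinkCoset G u)) = QuotientGroup.mk 1 := by
        rw [MulAction.Quotient.smul_mk, QuotientGroup.eq]
        refine ⟨(gen G w)⁻¹, ?_⟩
        rw [map_inv, ret_gen_of_mem (S := G.neighborSet u) hw]
        simp
      ext <;> simp [this]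
    intro a b hab
    split_ifs with h1 h2 h2
    · exact Commute.refl _
    · exact key _ (h1 ▸ hab)
    · exact (key _ (h2 ▸ hab.symm)).symm
    · exact (gen_commute hab).map SemidirectProduct.inr)

/-- The map from the free group on cosets back to `RAAG G`. -/
def unsplit : FreeGroup (LinkCoset G u) →* RAAG G :=
  FreeGroup.lift (Quotient.lift (fun a => a * gen G u * a⁻¹) (by
    intro a b hab
    obtain ⟨c, hc⟩ := QuotientGroup.leftRel_apply.1 hab
    have := commute_ret (G := G) (S := G.neighborSet u) (v := u)
      (fun w hw => mem_star.2 (Or.inr hw)) c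
    rw [hc] at this
    have h2 : a⁻¹ * b * gen G u * (a⁻¹ * b)⁻¹ = gen G u := by rw [this.eq]; group
    conv_lhs => rw [← h2]
    group))

variable {G}

lemma unsplit_act (a : RAAG G) (p : FreeGroup (LinkCoset G u)) :
    unsplit G u (act G u a p) = a * unsplit G u p * a⁻¹ := by
  have : (unsplit G u).comp (act G u a).toMonoidHom =
      (MulAut.conj a).toMonoidHom.comp (unsplit G u) := by
    ext t
    induction t using QuotientGroup.induction_on with
    | H z =>
      simp only [MonoidHom.comp_apply, MulEquiv.coe_toMonoidHom, act_of, MulAut.conj_apply,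
        unsplit, FreeGroup.lift_apply_of, MulAction.Quotient.smul_mk, smul_eq_mul]
      change a * z * gen G u * (a * z)⁻¹ = a * (z * gen G u * z⁻¹) * a⁻¹
      group
  exact DFunLike.congr_fun this p

lemma split_right (g : RAAG G) : (split G u g).right = ret G {u}ᶜ g := by
  have : SemidirectProduct.rightHom.comp (split G u) = ret G {u}ᶜ := hom_ext fun w => by
    by_cases hw : w = u <;> simp [split, ret, hw]
  exact DFunLike.congr_fun this g

lemma split_gen_of_ne {w : V} (h : w ≠ u) :
    split G u (gen G w) = SemidirectProduct.inr (gen G w) := by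
  simp [split, h]

lemma eq_unsplit_mul (g : RAAG G) :
    g = unsplit G u (split G u g).left * ret G {u}ᶜ g := by
  have : (SemidirectProduct.lift (unsplit G u) (MonoidHom.id _) (fun a => by
      ext t; simp [-act_of, unsplit_act])).comp (split G u) = MonoidHom.id (RAAG G) :=
    hom_ext fun w => by
      by_cases hw : w = u
      · subst hw
        simp only [split, MonoidHom.comp_apply, lift_gen, if_true, SemidirectProduct.lift_inl,
          unsplit, FreeGroup.lift_apply_of, MonoidHom.id_apply]
        change 1 * gen G w * 1⁻¹ = _
        simp
      · simp [split, hw]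
  conv_lhs => rw [← MonoidHom.id_apply (M := RAAG G) g, ← this, MonoidHom.comp_apply,
    ← SemidirectProduct.inl_left_mul_inr_right (split G u g), map_mul,
    SemidirectProduct.lift_inl, SemidirectProduct.lift_inr, split_right]
  rfl

variable {u} {x : V}

/-- The exponent sum of `x` on cosets of the link subgroup of `u`, where `x ∉ lk(u)`. -/
def cosetDeg (hx : ¬G.Adj u x) : LinkCoset G u → ℤ :=
  Quotient.lift (deg x) (by
    intro a b hab
    obtain ⟨c, hc⟩ := QuotientGroup.leftRel_apply.1 hab
    have h := deg_ret_of_notMem (G := G) (S := G.neighborSet u) (v := x) hx c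
    rw [hc, deg_mul, deg_inv] at h
    omega)

lemma cosetDeg_smul (hx : ¬G.Adj u x) (a : RAAG G) (t : LinkCoset G u) :
    cosetDeg hx (a • t) = deg x a + cosetDeg hx t := by
  induction t using QuotientGroup.induction_on with
  | H z => exact deg_mul x a z

open Classical in
/-- The endomorphism killing the cosets whose exponent sum of `x` lies outside `S`. -/
def kill (hx : ¬G.Adj u x) (S : Set ℤ) :
    FreeGroup (LinkCoset G u) →* FreeGroup (LinkCoset G u) :=
  FreeGroup.lift fun t => if cosetDeg hx t ∈ S then FreeGroup.of t else 1

lemma kill_act (hx : ¬G.Adj u x) (S : Set ℤ) (a : RAAG G) (p : FreeGroup (LinkCoset G u)) :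
    kill hx S (act G u a p) = act G u a (kill hx {n | deg x a + n ∈ S} p) := by
  have : (kill hx S).comp (act G u a).toMonoidHom =
      (act G u a).toMonoidHom.comp (kill hx {n | deg x a + n ∈ S}) := by
    ext t
    by_cases h : deg x a + cosetDeg hx t ∈ S <;> simp [kill, cosetDeg_smul, h]
  exact DFunLike.congr_fun this p

lemma kill_kill (hx : ¬G.Adj u x) (S T : Set ℤ) (p : FreeGroup (LinkCoset G u)) :
    kill hx S (kill hx T p) = kill hx (S ∩ T) p := by
  have : (kill hx S).comp (kill hx T) = kill hx (S ∩ T) := by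
    ext t
    by_cases hT : cosetDeg hx t ∈ T <;> by_cases hS : cosetDeg hx t ∈ S <;> simp [kill, hS, hT]
  exact DFunLike.congr_fun this p

lemma kill_empty (hx : ¬G.Adj u x) (p : FreeGroup (LinkCoset G u)) : kill hx ∅ p = 1 := by
  have : kill hx ∅ = (1 : FreeGroup (LinkCoset G u) →* _) := by ext t; simp [kill]
  exact DFunLike.congr_fun this p

lemma exists_kill_eq (hx : ¬G.Adj u x) (p : FreeGroup (LinkCoset G u)) :
    ∃ M : ℕ, kill hx (Set.Icc (-M) M) p = p := by
  have mono : ∀ {M N : ℕ} {q}, M ≤ N → kill hx (Set.Icc (-M : ℤ) M) q = q →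
      kill hx (Set.Icc (-N : ℤ) N) q = q := by
    intro M N q h hq
    conv_lhs => rw [← hq]
    rw [kill_kill, Set.inter_eq_right.2 (Set.Icc_subset_Icc (by omega) (by omega)), hq]
  induction p using FreeGroup.induction_on with
  | C1 => exact ⟨0, map_one _⟩
  | of t =>
    refine ⟨(cosetDeg hx t).natAbs, ?_⟩
    have : cosetDeg hx t ∈ Set.Icc (-((cosetDeg hx t).natAbs : ℤ)) (cosetDeg hx t).natAbs :=
      ⟨by omega, by omega⟩
    simp only [kill, FreeGroup.lift_apply_of, if_pos this]
  | inv_of t ih =>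
    obtain ⟨M, hM⟩ := ih
    exact ⟨M, by rw [map_inv, hM]⟩
  | mul a b ha hb =>
    obtain ⟨M, hM⟩ := ha
    obtain ⟨N, hN⟩ := hb
    exact ⟨max M N, by rw [map_mul, mono (le_max_left _ _) hM, mono (le_max_right _ _) hN]⟩

/-- If `kill` fixes `p` on the window `[-M, M]`, it annihilates translates of `p` far away. -/
lemma kill_act_eq_one (hx : ¬G.Adj u x) {M : ℕ} {p : FreeGroup (LinkCoset G u)}
    (hp : kill hx (Set.Icc (-M) M) p = p) {a : RAAG G} (ha : 2 * (M : ℤ) < |deg x a|) :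
    kill hx (Set.Icc (-M) M) (act G u a p) = 1 := by
  rw [kill_act]
  conv_lhs => rw [← hp]
  rw [kill_kill]
  have : {n : ℤ | deg x a + n ∈ Set.Icc (-(M : ℤ)) M} ∩ Set.Icc (-(M : ℤ)) M = ∅ := by
    ext n
    simp only [Set.mem_inter_iff, Set.mem_ofPred_eq, Set.mem_Icc, Set.mem_empty_iff_false,
      iff_false]
    rcases abs_cases (deg x a) with h | h <;> omega
  rw [this, kill_empty, map_one]

end Splitting

/-- An element `w` commuting with `y` is conjugate into the subgroup avoiding `u`, provided some
`x ∉ st(u)` has exponent sum zero in `w` and nonzero in `y`. -/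
lemma exists_conj_ret {u x : V} (hx : x ∉ _root_.star G u) {w y : RAAG G} (h : Commute w y)
    (hw : deg x w = 0) (hy : deg x y ≠ 0) : ∃ k, w = k * ret G {u}ᶜ w * k⁻¹ := by
  rw [mem_star, not_or] at hx
  obtain ⟨hxu, hx⟩ := hx
  obtain ⟨M, hM⟩ := exists_kill_eq hx (split G u w).left
  set p := (split G u w).left
  have hc : Commute w (y ^ (2 * M + 1)) := h.pow_right _
  set q := (split G u (y ^ (2 * M + 1))).left
  have e := congrArg SemidirectProduct.left (hc.map (split G u)).eq
  rw [SemidirectProduct.mul_left, SemidirectProduct.mul_left, split_right, split_right] at e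
  have e2 := congrArg (kill hx (Set.Icc (-M) M)) e
  have hxm : x ∈ ({u}ᶜ : Set V) := hxu
  rw [map_mul, map_mul, hM, kill_act_eq_one hx hM, mul_one, kill_act, deg_ret_of_mem hxm, hw] at e2
  · simp only [zero_add, Set.ofPred_mem_eq] at e2
    refine ⟨unsplit G u (kill hx (Set.Icc (-M) M) q), ?_⟩
    conv_lhs => rw [eq_unsplit_mul u w]
    have e3 := congrArg (unsplit G u) e2
    rw [map_mul, unsplit_act] at e3
    change unsplit G u p * _ = unsplit G u (kill hx (Set.Icc (-M) M) q) at e3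
    change unsplit G u p * _ = _
    have fin : ∀ P R K : RAAG G, P * (R * K * R⁻¹) = K → P * R = K * R * K⁻¹ := fun P R K e => by
      rw [eq_mul_inv_of_mul_eq e]
      group
    exact fin _ _ _ e3
  · rw [deg_ret_of_mem hxm, deg_pow, abs_mul]
    have : 1 ≤ |deg x y| := Int.one_le_abs hy
    have h3 : |((2 * M + 1 : ℕ) : ℤ)| = 2 * M + 1 := by rw [abs_of_nonneg] <;> push_cast <;> omega
    rw [h3]
    nlinarith

lemma ret_star_of_commute [Finite V] {v : V} {g : RAAG G} (h : Commute g (gen G v)) :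
    ret G (_root_.star G v) g = g := by
  refine inter_closed (P := fun S => ret G S g = g) (ret_univ g)
    (fun R T => ret_inter_eq) _ fun t ht => ?_
  rw [mem_star, not_or] at ht
  have hx : ¬G.Adj t v := fun e => ht.2 e.symm
  obtain ⟨M, hM⟩ := exists_kill_eq hx (split G t g).left
  have e := congrArg SemidirectProduct.left ((h.pow_right (2 * M + 1)).map (split G t)).eq
  rw [map_pow, split_gen_of_ne t (Ne.symm ht.1), ← map_pow] at e
  simp only [SemidirectProduct.mul_left, SemidirectProduct.left_inr, map_one, mul_one, one_mul,
    SemidirectProduct.right_inr] at e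
  have e2 := congrArg (kill hx (Set.Icc (-M) M)) e
  rw [kill_act_eq_one hx hM, hM] at e2
  · conv_rhs => rw [eq_unsplit_mul t g, e2]
    simp
  · rw [deg_pow, deg_gen_self, abs_of_nonneg] <;> push_cast <;> omega

/-! ### The action of automorphisms on exponent sums -/

/-- The integral Heisenberg group. -/
@[ext] structure Heis where
  /-- The first coordinate. -/
  x : ℤ
  /-- The second coordinate. -/
  y : ℤ
  /-- The central coordinate. -/
  z : ℤ

namespace Heis

instance : Mul Heis := ⟨fun p q => ⟨p.x + q.x, p.y + q.y, p.z + q.z + p.x * q.y⟩⟩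

instance : One Heis := ⟨⟨0, 0, 0⟩⟩

instance : Inv Heis := ⟨fun p => ⟨-p.x, -p.y, -p.z + p.x * p.y⟩⟩

lemma mul_eq (p q : Heis) : p * q = ⟨p.x + q.x, p.y + q.y, p.z + q.z + p.x * q.y⟩ := rfl

lemma one_eq : (1 : Heis) = ⟨0, 0, 0⟩ := rfl

lemma inv_eq (p : Heis) : p⁻¹ = ⟨-p.x, -p.y, -p.z + p.x * p.y⟩ := rfl

instance : Group Heis := Group.ofLeftAxioms
  (fun a b c => by ext <;> simp only [mul_eq] <;> ring)
  (fun a => by ext <;> simp [mul_eq, one_eq])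
  (fun a => by ext <;> simp [mul_eq, one_eq, inv_eq])

/-- The first coordinate as a homomorphism. -/
def xHom : Heis →* Multiplicative ℤ where
  toFun p := Multiplicative.ofAdd p.x
  map_one' := rfl
  map_mul' _ _ := rfl

/-- The second coordinate as a homomorphism. -/
def yHom : Heis →* Multiplicative ℤ where
  toFun p := Multiplicative.ofAdd p.y
  map_one' := rfl
  map_mul' _ _ := rfl

lemma mul_eq_of_commute {p q : Heis} (h : Commute p q) : p.x * q.y = p.y * q.x := by
  have := congrArg Heis.z h.eq
  simp only [mul_eq] at this
  linarith

end Heis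

lemma deg_mul_deg_of_commute {g h : RAAG G} (hc : Commute g h) {i j : V} (hij : i ≠ j)
    (ha : ¬G.Adj i j) : deg i g * deg j h = deg j g * deg i h := by
  classical
  let θ : RAAG G →* Heis :=
    lift (fun w => if w = i then ⟨1, 0, 0⟩ else if w = j then ⟨0, 1, 0⟩ else 1) (by
      intro a b hab
      by_cases h1 : a = i
      · have h2 : b ≠ i := fun e => hab.ne (h1.trans e.symm)
        have h3 : b ≠ j := fun e => ha (h1 ▸ e ▸ hab)
        simp [h2, h3]
      · by_cases h2 : b = i
        · have h3 : a ≠ j := fun e => ha (h2 ▸ e ▸ hab.symm)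
          simp [h1, h3]
        · by_cases h3 : a = j
          · have h4 : b ≠ j := fun e => hab.ne (h3.trans e.symm)
            simp [h2, h4]
          · simp [h1, h3])
  have hx : ∀ g, (θ g).x = deg i g := by
    have : Heis.xHom.comp θ = expHom G i := hom_ext fun w => by
      by_cases h1 : w = i
      · simp [θ, expHom, Heis.xHom, h1]
      · by_cases h2 : w = j <;> simp [θ, expHom, Heis.xHom, h1, h2, hij.symm, Heis.one_eq]
    exact fun g => congrArg Multiplicative.toAdd (DFunLike.congr_fun this g)
  have hy : ∀ g, (θ g).y = deg j g := by
    have : Heis.yHom.comp θ = expHom G j := hom_ext fun w => by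
      by_cases h1 : w = i
      · simp [θ, expHom, Heis.yHom, h1, hij]
      · by_cases h2 : w = j <;> simp [θ, expHom, Heis.yHom, h1, h2, hij.symm, Heis.one_eq]
    exact fun g => congrArg Multiplicative.toAdd (DFunLike.congr_fun this g)
  simpa only [hx, hy] using Heis.mul_eq_of_commute (hc.map θ)

lemma deg_map [Fintype V] (f : RAAG G →* RAAG G) (v : V) (g : RAAG G) :
    deg v (f g) = ∑ w, deg v (f (gen G w)) * deg w g := by
  classical
  induction g using gen_induction with
  | h1 => simp
  | hg u => simp [deg_gen]
  | hm a b ha hb => simp [ha, hb, mul_add, Finset.sum_add_distrib]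
  | hi a ha => simp [ha]

lemma card_star_le_and_dominates [Fintype V] [DecidableEq V] [DecidableRel G.Adj]
    (A : V → V → ℚ) (hli : LinearIndependent ℚ fun x j => A j x)
    (hc : ∀ v, ∀ x ∈ _root_.star G v, ∀ i j, i ≠ j → ¬G.Adj i j →
      A i v * A j x = A j v * A i x)
    {v w : V} (hw : A w v ≠ 0) :
    Nat.card (_root_.star G v) ≤ Nat.card (_root_.star G w) ∧
      (Nat.card (_root_.star G v) = Nat.card (_root_.star G w) →
        ∀ t, A t v ≠ 0 → Dominates G t w) := by
  have : Fintype (_root_.star G v) := Fintype.ofFinite _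
  have : Fintype (_root_.star G w) := Fintype.ofFinite _
  let b : (_root_.star G v → ℚ) → V → ℚ := fun c j => ∑ x, c x * A j x
  have hb : ∀ c i j, i ≠ j → ¬G.Adj i j → A i v * b c j = A j v * b c i := by
    intro c i j hij ha
    simp only [b, Finset.mul_sum]
    refine Finset.sum_congr rfl fun x _ => ?_
    linear_combination c x * hc v x x.2 i j hij ha
  have hb0 : ∀ c, b c w = 0 → ∀ j ∉ _root_.star G w, b c j = 0 := by
    intro c h0 j hj
    rw [mem_star, not_or] at hj
    have := hb c w j (Ne.symm hj.1) hj.2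
    rw [h0, mul_zero] at this
    exact (mul_eq_zero.1 this).resolve_left hw
  let L : (_root_.star G v → ℚ) →ₗ[ℚ] (_root_.star G w → ℚ) :=
    { toFun := fun c j => b c j
      map_add' := by
        intro c d; ext j
        simp [b, add_mul, Finset.sum_add_distrib]
      map_smul' := by
        intro c d; ext j
        simp [b, Finset.mul_sum, mul_assoc] }
  have hwm : w ∈ _root_.star G w := mem_star.2 (Or.inl rfl)
  have hL : Function.Injective L := by
    rw [← LinearMap.ker_eq_bot, LinearMap.ker_eq_bot']
    intro c hc0
    have h1 : ∀ j ∈ _root_.star G w, b c j = 0 := fun j hj => congrFun hc0 ⟨j, hj⟩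
    have h2 : ∀ j, b c j = 0 := fun j => by
      by_cases hj : j ∈ _root_.star G w
      · exact h1 j hj
      · exact hb0 c (h1 w hwm) j hj
    have h3 := Fintype.linearIndependent_iff.1
      (hli.comp (Subtype.val : _root_.star G v → V) Subtype.val_injective) c (by
        ext j
        simpa [b] using h2 j)
    exact funext h3
  refine ⟨?_, fun hcard t ht x hx => ?_⟩
  · simpa [Nat.card_eq_fintype_card] using LinearMap.finrank_le_finrank_of_injective hL
  · have hs := (LinearMap.injective_iff_surjective_of_finrank_eq_finrank (f := L)
      (by simpa [Nat.card_eq_fintype_card] using hcard)).1 hL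
    have hxs : x ∈ _root_.star G w := mem_star.2 (Or.inr hx)
    obtain ⟨c, hcx⟩ := hs (Pi.single ⟨x, hxs⟩ 1)
    have h1 : ∀ j (hj : j ∈ _root_.star G w), b c j = if j = x then 1 else 0 := by
      intro j hj
      have := congrFun hcx ⟨j, hj⟩
      simpa [L, Pi.single_apply] using this
    have hxw : w ≠ x := fun e => G.irrefl (v := w) (by rw [← e] at hx; exact hx)
    have h0 : b c w = 0 := by simp [h1 w hwm, hxw]
    rw [mem_star]
    by_contra hcon
    rw [not_or] at hcon
    have h4 := hb c t x (Ne.symm hcon.1) hcon.2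
    have h5 : b c t = 0 := by
      by_cases hj : t ∈ _root_.star G w
      · simp [h1 t hj, Ne.symm hcon.1]
      · exact hb0 c h0 t hj
    rw [h1 x hxs, h5] at h4
    simp at h4
    exact ht h4

/-- An automorphism of the Artin group of an austere graph acts on exponent sums by signs. -/
lemma deg_mulAut [Fintype V] (hA : Austere G) (f : MulAut (RAAG G)) :
    (∀ v w, w ≠ v → deg w (f (gen G v)) = 0) ∧
      ∀ v, deg v (f (gen G v)) = 1 ∨ deg v (f (gen G v)) = -1 := by
  classical
  have hdiag : ∀ f : MulAut (RAAG G), ∀ v w, w ≠ v → deg w (f (gen G v)) = 0 := by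
    intro f
    let M : MulAut (RAAG G) → Matrix V V ℤ := fun f => .of fun w v => deg w (f (gen G v))
    have hmul : M f * M f⁻¹ = 1 := by
      ext i j
      rw [Matrix.mul_apply]
      have := deg_map (f : RAAG G →* RAAG G) i (f⁻¹ (gen G j))
      simp only [MonoidHom.coe_coe] at this
      simp only [M, Matrix.of_apply, ← this, ← MulAut.mul_apply, mul_inv_cancel, MulAut.one_apply]
      simp [deg_gen, Matrix.one_apply, eq_comm]
    have hdet : (M f).det ≠ 0 := by
      intro h
      have := congrArg Matrix.det hmul
      simp [Matrix.det_mul, h] at this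
    obtain ⟨σ, -, hσ⟩ : ∃ σ ∈ (Finset.univ : Finset (Equiv.Perm V)),
        Equiv.Perm.sign σ • ∏ i, M f (σ i) i ≠ 0 := by
      apply Finset.exists_ne_zero_of_sum_ne_zero
      rwa [← Matrix.det_apply]
    have hσ' : ∀ v, M f (σ v) v ≠ 0 := fun v h0 => hσ (by
      rw [Finset.prod_eq_zero (f := fun i => M f (σ i) i) (Finset.mem_univ v) h0, smul_zero])
    let A : V → V → ℚ := fun w v => (M f w v : ℚ)
    have hli : LinearIndependent ℚ fun x j => A j x := by
      have hu : IsUnit ((M f).map (Int.cast : ℤ → ℚ)) := by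
        rw [Matrix.isUnit_iff_isUnit_det, isUnit_iff_ne_zero]
        have := Int.cast_det (R := ℚ) (M f)
        rw [← this]
        exact_mod_cast hdet
      exact Matrix.linearIndependent_cols_iff_isUnit.2 hu
    have hc' : ∀ v, ∀ x ∈ _root_.star G v, ∀ i j, i ≠ j → ¬G.Adj i j →
        M f i v * M f j x = M f j v * M f i x := by
      intro v x hx i j hij ha
      refine deg_mul_deg_of_commute ?_ hij ha
      refine Commute.map ?_ f
      rcases mem_star.1 hx with rfl | h
      · exact Commute.refl _
      · exact gen_commute h
    have hkey := fun v w => card_star_le_and_dominates A hli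
      (fun v x hx i j hij ha => by simp only [A]; exact_mod_cast hc' v x hx i j hij ha)
      (v := v) (w := w)
    have hle : ∀ v ∈ (Finset.univ : Finset V),
        Nat.card (_root_.star G v) ≤ Nat.card (_root_.star G (σ v)) :=
      fun v _ => (hkey v (σ v) (Int.cast_ne_zero.2 (hσ' v))).1
    have heq := (Finset.sum_eq_sum_iff_of_le hle).1
      (Equiv.sum_comp σ fun v => Nat.card (_root_.star G v)).symm
    have hsupp : ∀ v t, t ≠ σ v → M f t v = 0 := by
      intro v t ht
      by_contra h0
      exact hA.2.1 t (σ v) ht ((hkey v (σ v) (Int.cast_ne_zero.2 (hσ' v))).2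
        (heq v (Finset.mem_univ v)) t (Int.cast_ne_zero.2 h0))
    have hadj : ∀ u v, G.Adj u v → G.Adj (σ u) (σ v) := by
      intro u v huv
      by_contra ha
      have hne : σ u ≠ σ v := fun e => huv.ne (σ.injective e)
      have := hc' u v (mem_star.2 (Or.inr huv)) (σ u) (σ v) hne ha
      rw [hsupp u (σ v) hne.symm, zero_mul] at this
      exact (mul_ne_zero (hσ' u) (hσ' v)) this
    have hpow : ∀ (k : ℕ) u v, G.Adj u v → G.Adj ((σ ^ k) u) ((σ ^ k) v) := by
      intro k
      induction k with
      | zero => intro u v h; simpa using h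
      | succ k ih =>
        intro u v h
        rw [pow_succ', Equiv.Perm.mul_apply, Equiv.Perm.mul_apply]
        exact hadj _ _ (ih u v h)
    have hinv : ∀ u v, G.Adj (σ u) (σ v) → G.Adj u v := by
      intro u v h
      have h1 := hpow (orderOf σ - 1) _ _ h
      rwa [← Equiv.Perm.mul_apply, ← Equiv.Perm.mul_apply, ← pow_succ,
        Nat.sub_add_cancel (orderOf_pos σ), pow_orderOf_eq_one] at h1
    have hid := hA.1 ⟨σ, fun {a b} => ⟨hinv a b, hadj a b⟩⟩
    intro v w hw
    exact hsupp v w (fun e => hw (e.trans (hid v)))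
  refine ⟨hdiag f, fun v => ?_⟩
  have := deg_map (f : RAAG G →* RAAG G) v (f⁻¹ (gen G v))
  simp only [MonoidHom.coe_coe] at this
  rw [Finset.sum_eq_single v (fun b _ hb => by rw [hdiag f b v hb.symm, zero_mul]) (by simp),
    ← MulAut.mul_apply, mul_inv_cancel, MulAut.one_apply, deg_gen_self] at this
  exact Int.eq_one_or_neg_one_of_mul_eq_one this.symm


/-! ### Automorphisms acting trivially on exponent sums are inner -/

/-- An element conjugated into the subgroup of `R` by `k` can be conjugated within it. -/
lemma conj_ret {R : Set V} {k x : RAAG G} (m : RAAG G) (h : ret G R (k⁻¹ * x * k) = k⁻¹ * x * k) :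
    (k * ret G R (k⁻¹ * m))⁻¹ * x * (k * ret G R (k⁻¹ * m)) = ret G R (m⁻¹ * x * m) := by
  have e : m⁻¹ * x * m = (k⁻¹ * m)⁻¹ * (k⁻¹ * x * k) * (k⁻¹ * m) := by group
  rw [e]
  generalize k⁻¹ * m = q
  rw [map_mul, map_mul, h, map_inv]
  group

lemma conj_ret_inter {R T : Set V} {k m x : RAAG G} (hR : ret G R (k⁻¹ * x * k) = k⁻¹ * x * k)
    (hT : ret G T (m⁻¹ * x * m) = m⁻¹ * x * m) :
    ret G (R ∩ T) ((k * ret G R (k⁻¹ * m))⁻¹ * x * (k * ret G R (k⁻¹ * m))) =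
      (k * ret G R (k⁻¹ * m))⁻¹ * x * (k * ret G R (k⁻¹ * m)) := by
  rw [conj_ret m hR, ← hT, ret_ret R T, ret_idem]

lemma eq_conj_of_ret_singleton {v : V} {x k : RAAG G} (hx : deg v x = 1)
    (h : ret G {v} (k⁻¹ * x * k) = k⁻¹ * x * k) : x = k * gen G v * k⁻¹ := by
  rw [ret_singleton] at h
  have : deg v (k⁻¹ * x * k) = 1 := by simp [hx]
  rw [this, zpow_one] at h
  rw [h]
  group

lemma exists_conj_gen [Finite V] (hd : ∀ u v : V, u ≠ v → ¬Dominates G u v)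
    (f : RAAG G →* RAAG G) (hf : ∀ v w, deg w (f (gen G v)) = deg w (gen G v)) (v : V) :
    ∃ g, f (gen G v) = g * gen G v * g⁻¹ := by
  obtain ⟨k, hk⟩ := inter_closed
    (P := fun R => ∃ k, ret G R (k⁻¹ * f (gen G v) * k) = k⁻¹ * f (gen G v) * k)
    ⟨1, ret_univ _⟩ (fun R T ⟨k, hk⟩ ⟨m, hm⟩ => ⟨_, conj_ret_inter hk hm⟩) {v} (fun u hu => by
      obtain ⟨x, hvx, hx⟩ := Set.not_subset.1 (hd u v hu)
      have hvx' : G.Adj v x := hvx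
      obtain ⟨k, hk⟩ := exists_conj_ret hx ((gen_commute hvx').map f)
        (by rw [hf, deg_gen_of_ne hvx'.ne]) (by rw [hf, deg_gen_self]; exact one_ne_zero)
      refine ⟨k, ?_⟩
      have e : k⁻¹ * f (gen G v) * k = ret G {u}ᶜ (f (gen G v)) := by
        conv_lhs => rw [hk]
        group
      rw [e, ret_idem])
  exact ⟨k, eq_conj_of_ret_singleton (by rw [hf, deg_gen_self]) hk⟩

lemma exists_common_conj [Finite V] {v w : V} (hvw : G.Adj v w) {x y g g' : RAAG G}
    (hx : x = g * gen G v * g⁻¹) (hy : y = g' * gen G w * g'⁻¹) (h : Commute x y) :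
    ∃ k, x = k * gen G v * k⁻¹ ∧ y = k * gen G w * k⁻¹ := by
  set d := g⁻¹ * g' with hd
  have h1 : Commute (d * gen G w * d⁻¹) (gen G v) := by
    have e1 : gen G v = MulAut.conj g⁻¹ x := by rw [hx, MulAut.conj_apply]; group
    have e2 : d * gen G w * d⁻¹ = MulAut.conj g⁻¹ y := by rw [hy, MulAut.conj_apply, hd]; group
    rw [e1, e2]
    exact h.symm.map _
  have h2 := ret_star_of_commute h1
  rw [map_mul, map_mul, map_inv, ret_gen_of_mem (mem_star.2 (Or.inr hvw))] at h2
  have h3 : Commute (ret G (_root_.star G v) d) (gen G v) := commute_ret subset_rfl d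
  refine ⟨g * ret G (_root_.star G v) d, ?_, ?_⟩
  · rw [mul_assoc g, h3.eq, hx]
    group
  · have e : ∀ r : RAAG G, g * r * gen G w * (g * r)⁻¹ = g * (r * gen G w * r⁻¹) * g⁻¹ := by
      intro r
      group
    rw [e, h2, hy, hd]
    group

lemma commute_of_conj_eq {v : V} {k k' : RAAG G}
    (h : k * gen G v * k⁻¹ = k' * gen G v * k'⁻¹) : Commute (k⁻¹ * k') (gen G v) := by
  have e : k⁻¹ * k' * gen G v = k⁻¹ * (k' * gen G v * k'⁻¹) * k' := by group
  rw [Commute, SemiconjBy, e, ← h]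
  group

lemma ret_compl_of_conj_eq [Finite V] {u v : V} (hv : v ∉ _root_.star G u) {k k' : RAAG G}
    (h : k * gen G v * k⁻¹ = k' * gen G v * k'⁻¹) : ret G {u}ᶜ (k⁻¹ * k') = k⁻¹ * k' := by
  refine ret_eq_of_subset (fun w hw => ?_) (ret_star_of_commute (commute_of_conj_eq h))
  rintro rfl
  rcases mem_star.1 hw with rfl | h'
  · exact hv hw
  · exact hv (mem_star.2 (Or.inr h'.symm))

lemma ret_mul_eq {S : Set V} {g h : RAAG G} (hg : ret G S g = g) (hh : ret G S h = h) :
    ret G S (g * h) = g * h := by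
  rw [map_mul, hg, hh]

lemma ret_inv_eq {S : Set V} {g : RAAG G} (hg : ret G S g = g) : ret G S g⁻¹ = g⁻¹ := by
  rw [map_inv, hg]

/-- The conjugators at all vertices other than `u` agree modulo the subgroup avoiding `u`. -/
lemma exists_conj_away [Finite V] (hA : Austere G) (f : RAAG G →* RAAG G)
    (hf : ∀ v, ∃ g, f (gen G v) = g * gen G v * g⁻¹) (u : V) :
    ∃ h, ∀ v, v ≠ u → ∃ k, f (gen G v) = k * gen G v * k⁻¹ ∧ ret G {u}ᶜ (h⁻¹ * k) = h⁻¹ * k := by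
  obtain ⟨hp, ⟨v₀, hv₀⟩⟩ := SimpleGraph.connected_iff _ |>.1 (hA.2.2 u)
  obtain ⟨h, hh⟩ := hf v₀
  let Q : V → Prop := fun v =>
    ∃ k, f (gen G v) = k * gen G v * k⁻¹ ∧ ret G {u}ᶜ (h⁻¹ * k) = h⁻¹ * k
  have step : ∀ v w, v ∉ _root_.star G u → G.Adj v w → Q v → Q w := by
    rintro v w hv hvw ⟨k, hk, hk'⟩
    obtain ⟨l, hl⟩ := hf w
    obtain ⟨m, hm, hm'⟩ := exists_common_conj hvw hk hl ((gen_commute hvw).map f)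
    refine ⟨m, hm', ?_⟩
    have e : h⁻¹ * m = h⁻¹ * k * (k⁻¹ * m) := by group
    rw [e]
    exact ret_mul_eq hk' (ret_compl_of_conj_eq hv (hk.symm.trans hm))
  have hQ : ∀ v, v ∉ _root_.star G u → Q v := by
    intro v hv
    obtain ⟨p⟩ := hp ⟨v₀, hv₀⟩ ⟨v, hv⟩
    have main : ∀ a b : ((_root_.star G u)ᶜ : Set V),
        (G.induce (_root_.star G u)ᶜ).Walk a b → Q a → Q b := by
      intro a b p
      induction p with
      | nil => exact id
      | @cons a b c hab _ ih => exact fun ha => ih (step a b a.2 hab ha)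
    exact main _ _ p ⟨h, hh, by simp⟩
  refine ⟨h, fun v hvu => ?_⟩
  by_cases hv : v ∈ _root_.star G u
  · obtain ⟨x, hvx, hx⟩ := Set.not_subset.1 (hA.2.1 u v hvu.symm)
    exact step x v hx (SimpleGraph.Adj.symm hvx) (hQ x hx)
  · exact hQ v hv

/-- Up to an inner automorphism fixing `u`, all other generators are mapped into the subgroup
avoiding `u`. -/
lemma exists_conj_avoiding [Finite V] (hA : Austere G) (f : RAAG G →* RAAG G)
    (hf : ∀ v, ∃ g, f (gen G v) = g * gen G v * g⁻¹) (u : V) :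
    ∃ h, f (gen G u) = h * gen G u * h⁻¹ ∧
      ∀ v, v ≠ u → ret G {u}ᶜ (h⁻¹ * f (gen G v) * h) = h⁻¹ * f (gen G v) * h := by
  obtain ⟨g, hg⟩ := hf u
  obtain ⟨h, hh⟩ := exists_conj_away hA f hf u
  set d := g⁻¹ * h with hd
  have key : ret G {u}ᶜ (d⁻¹ * ret G (_root_.star G u) d) = d⁻¹ * ret G (_root_.star G u) d := by
    refine inter_closed (P := fun R => ret G {u}ᶜ (d⁻¹ * ret G R d) = d⁻¹ * ret G R d)
      (by simp [ret_univ]) (fun R T hR hT => ?_) _ fun t ht => ?_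
    · have e : d⁻¹ * ret G (R ∩ T) d = d⁻¹ * ret G R d * ret G R (d⁻¹ * ret G T d) := by
        rw [map_mul _ d⁻¹, ret_ret R T, map_inv]
        group
      rw [e]
      exact ret_mul_eq hR (by rw [ret_comm, hT])
    · obtain ⟨v, huv, hv⟩ := Set.not_subset.1
        (hA.2.1 t u fun e => ht (mem_star.2 (Or.inl e)))
      have huv' : G.Adj u v := huv
      obtain ⟨k, hk, hk'⟩ := hh v huv'.ne'
      obtain ⟨m, hm, hm'⟩ := exists_common_conj huv' hg hk ((gen_commute huv').map f)
      have htu : u ∉ _root_.star G t := by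
        rw [mem_star, not_or] at ht ⊢
        exact ⟨Ne.symm ht.1, fun e => ht.2 e.symm⟩
      have h1 := ret_compl_of_conj_eq htu (hg.symm.trans hm)
      have h2 := ret_compl_of_conj_eq hv (hm'.symm.trans hk)
      have h3 : ret G {u}ᶜ (k⁻¹ * h) = k⁻¹ * h := by
        have := ret_inv_eq hk'
        rwa [mul_inv_rev, inv_inv] at this
      have e : d = (g⁻¹ * m) * (m⁻¹ * k) * (k⁻¹ * h) := by rw [hd]; group
      have e2 : d⁻¹ * ret G {t}ᶜ d = (k⁻¹ * h)⁻¹ * ret G {t}ᶜ (k⁻¹ * h) := by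
        rw [e, map_mul _ (_ * _) (k⁻¹ * h), ret_mul_eq h1 h2]
        group
      rw [e2]
      exact ret_mul_eq (ret_inv_eq h3) (by rw [ret_comm, h3])
  set e := ret G (_root_.star G u) d with he
  have hc : Commute e (gen G u) := commute_ret subset_rfl d
  refine ⟨g * e, ?_, fun v hv => ?_⟩
  · rw [mul_assoc g, hc.eq, hg]
    group
  · obtain ⟨k, hk, hk'⟩ := hh v hv
    have e1 : (g * e)⁻¹ * f (gen G v) * (g * e) =
        (d⁻¹ * e)⁻¹ * (h⁻¹ * k) * gen G v * ((d⁻¹ * e)⁻¹ * (h⁻¹ * k))⁻¹ := by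
      rw [hk, hd]
      group
    have h1 := ret_mul_eq (ret_inv_eq key) hk'
    rw [e1]
    exact ret_mul_eq (ret_mul_eq h1 (ret_gen_of_mem hv)) (ret_inv_eq h1)

/-- The inductive step: a family of conjugates of generators, standard on `S`, can be
conjugated to be standard at one more vertex. -/
lemma exists_centralizing_conj [Finite V] {F : V → RAAG G}
    (hF : ∀ u, ∃ h, F u = h * gen G u * h⁻¹ ∧
      ∀ v, v ≠ u → ret G {u}ᶜ (h⁻¹ * F v * h) = h⁻¹ * F v * h)
    {S : Set V} (hS : ∀ s ∈ S, F s = gen G s) {u : V}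
    (hFu : ret G (insert u S) (F u) = F u) :
    ∃ z, (∀ s ∈ S, Commute z (gen G s)) ∧ F u = z * gen G u * z⁻¹ := by
  let Z : Set V := {v | ∀ s ∈ S, v ∈ _root_.star G s}
  obtain ⟨z, hz, hz'⟩ := inter_closed (P := fun R => ∃ z, ret G Z z = z ∧
      ret G R (z⁻¹ * F u * z) = z⁻¹ * F u * z) ⟨1, map_one _, ret_univ _⟩
    (fun R T ⟨k, hkZ, hk⟩ ⟨m, hmZ, hm⟩ => ⟨_, ret_mul_eq hkZ (by
      rw [ret_comm, ret_mul_eq (ret_inv_eq hkZ) hmZ]), conj_ret_inter hk hm⟩) {u}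
    (fun t ht => by
      have htu : t ≠ u := ht
      by_cases htS : t ∈ S
      · obtain ⟨h, hh, hh'⟩ := hF t
        have hc : Commute h (gen G t) := by
          rw [hS t htS] at hh
          have := commute_of_conj_eq (k := 1) (k' := h) (by simpa using hh)
          simpa using this
        have e1 := ret_star_of_commute hc
        rw [ret_star] at e1
        set i := deg t h
        set c := ret G (G.neighborSet t) h with hcdef
        have hcB : ret G {t}ᶜ c = c := by
          refine ret_eq_of_subset (S := G.neighborSet t) ?_ (ret_idem _ _)
          rintro w hw rfl
          exact G.irrefl hw
        have h1 : ∀ w, w ≠ t → ret G {t}ᶜ ((gen G t ^ i)⁻¹ * F w * gen G t ^ i) =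
            (gen G t ^ i)⁻¹ * F w * gen G t ^ i := by
          intro w hw
          have h2 := hh' w hw
          rw [← e1] at h2
          have e2 : (gen G t ^ i)⁻¹ * F w * gen G t ^ i =
              c * ((gen G t ^ i * c)⁻¹ * F w * (gen G t ^ i * c)) * c⁻¹ := by group
          rw [e2]
          exact ret_mul_eq (ret_mul_eq hcB h2) (ret_inv_eq hcB)
        by_cases htZ : t ∈ Z
        · exact ⟨gen G t ^ i, by rw [map_zpow, ret_gen_of_mem htZ], h1 u htu.symm⟩
        · simp only [Z, Set.mem_ofPred_eq, not_forall] at htZ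
          obtain ⟨s, hsS, hst⟩ := htZ
          have hts : s ≠ t := fun e => hst (mem_star.2 (Or.inl e.symm))
          have h3 := h1 s hts
          rw [hS s hsS, map_mul, map_mul, map_inv, map_zpow, ret_gen_of_notMem (by simp),
            ret_gen_of_mem hts] at h3
          have h4 : Commute (gen G t ^ i) (gen G s) := by
            simp only [one_zpow, inv_one, one_mul, mul_one] at h3
            rw [Commute, SemiconjBy]
            conv_lhs => rw [h3]
            group
          have h5 := ret_star_of_commute h4
          rw [map_zpow, ret_gen_of_notMem hst, one_zpow] at h5
          have h6 := h1 u htu.symm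
          rw [← h5] at h6
          exact ⟨1, map_one _, h6⟩
      · refine ⟨1, map_one _, ?_⟩
        simp only [inv_one, one_mul, mul_one]
        refine ret_eq_of_subset ?_ hFu
        rintro w hw rfl
        exact hw.elim htu htS)
  obtain ⟨h, hh, -⟩ := hF u
  exact ⟨z, fun s hs => commute_of_ret_eq (S := Z) (fun v hv => hv s hs) hz,
    eq_conj_of_ret_singleton (by simp [hh]) hz'⟩

lemma exists_global_conj [Finite V] {F : V → RAAG G}
    (hF : ∀ u, ∃ h, F u = h * gen G u * h⁻¹ ∧
      ∀ v, v ≠ u → ret G {u}ᶜ (h⁻¹ * F v * h) = h⁻¹ * F v * h) :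
    ∃ g, ∀ v, F v = g * gen G v * g⁻¹ := by
  suffices h : ∀ S : Set V, S.Finite → ∃ g, ∀ v ∈ S, F v = g * gen G v * g⁻¹ by
    obtain ⟨g, hg⟩ := h Set.univ Set.finite_univ
    exact ⟨g, fun v => hg v trivial⟩
  intro S hS
  induction S, hS using Set.Finite.induction_on with
  | empty => exact ⟨1, fun v hv => hv.elim⟩
  | @insert u S _ _ ih =>
    obtain ⟨g, hg⟩ := ih
    obtain ⟨k, hk⟩ := inter_closed (P := fun R => ∃ k, ∀ v ∈ insert u S,
        ret G R (k⁻¹ * F v * k) = k⁻¹ * F v * k) ⟨1, fun v _ => ret_univ _⟩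
      (fun R T ⟨k, hk⟩ ⟨m, hm⟩ => ⟨_, fun v hv => conj_ret_inter (hk v hv) (hm v hv)⟩)
      (insert u S) (fun t ht => by
        obtain ⟨h, -, hh⟩ := hF t
        exact ⟨h, fun v hv => hh v fun e => ht (e ▸ hv)⟩)
    set a := k * ret G (insert u S) (k⁻¹ * g) with ha
    have ha' : ∀ v ∈ insert u S, a⁻¹ * F v * a = ret G (insert u S) (g⁻¹ * F v * g) :=
      fun v hv => conj_ret g (hk v hv)
    have haS : ∀ v ∈ S, a⁻¹ * F v * a = gen G v := by
      intro v hv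
      have e : g⁻¹ * F v * g = gen G v := by rw [hg v hv]; group
      rw [ha' v (Or.inr hv), e, ret_gen_of_mem (Set.mem_insert_of_mem u hv)]
    obtain ⟨z, hz, hzu⟩ := exists_centralizing_conj (F := fun v => a⁻¹ * F v * a) (fun w => by
      obtain ⟨h, hh, hh'⟩ := hF w
      refine ⟨a⁻¹ * h, ?_, fun v hv => ?_⟩
      · rw [hh]
        group
      · have e : (a⁻¹ * h)⁻¹ * (a⁻¹ * F v * a) * (a⁻¹ * h) = h⁻¹ * F v * h := by group
        rw [e, hh' v hv]) haS (by rw [ha' u (Or.inl rfl), ret_idem])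
    refine ⟨a * z, fun v hv => ?_⟩
    have h1 : a⁻¹ * F v * a = z * gen G v * z⁻¹ := by
      rcases hv with rfl | hv
      · exact hzu
      · rw [haS v hv, (hz v hv).eq, mul_inv_cancel_right]
    have e : F v = a * (a⁻¹ * F v * a) * a⁻¹ := by group
    rw [e, h1]
    group

/-- An automorphism of the Artin group of an austere graph acting trivially on exponent sums is
inner. -/
lemma exists_eq_conj [Finite V] (hA : Austere G) (f : MulAut (RAAG G))
    (hf : ∀ v w, deg w (f (gen G v)) = deg w (gen G v)) : ∃ g, f = MulAut.conj g := by
  obtain ⟨g, hg⟩ := exists_global_conj (exists_conj_avoiding hA (f : RAAG G →* RAAG G)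
    (exists_conj_gen hA.2.1 (f : RAAG G →* RAAG G) hf))
  refine ⟨g, MulEquiv.toMonoidHom_injective (hom_ext fun v => ?_)⟩
  exact hg v

/-! ### The structure of the automorphism group -/

lemma ret_empty (g : RAAG G) : ret G ∅ g = 1 := by
  have : ret G ∅ = 1 := hom_ext fun w => ret_gen_of_notMem (Set.notMem_empty w)
  exact DFunLike.congr_fun this g

lemma conj_injective [Finite V] (hA : Austere G) :
    Function.Injective (MulAut.conj : RAAG G →* MulAut (RAAG G)) := by
  refine (injective_iff_map_eq_one _).2 fun g hg => ?_
  rw [← ret_empty (G := G) g]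
  refine (inter_closed (P := fun S => ret G S g = g) (ret_univ g)
    (fun R T => ret_inter_eq) ∅ fun t _ => ?_).symm
  obtain ⟨-, ⟨w, hw⟩⟩ := SimpleGraph.connected_iff _ |>.1 (hA.2.2 t)
  have hc : Commute g (gen G w) := by
    have := DFunLike.congr_fun hg (gen G w)
    rw [MulAut.conj_apply, MulAut.one_apply] at this
    exact mul_inv_eq_iff_eq_mul.1 this
  refine ret_eq_of_subset ?_ (ret_star_of_commute hc)
  rintro x hx rfl
  rcases mem_star.1 hx with rfl | h
  · exact hw (mem_star.2 (Or.inl rfl))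
  · exact hw (mem_star.2 (Or.inr h.symm))

lemma mul_conj (f : MulAut (RAAG G)) (g : RAAG G) :
    f * MulAut.conj g = MulAut.conj (f g) * f := by
  ext x
  simp

lemma mulAut_ext {f g : MulAut (RAAG G)} (h : ∀ v, f (gen G v) = g (gen G v)) : f = g :=
  MulEquiv.toMonoidHom_injective (hom_ext h)

/-- The sign of an element of `ZMod 2`. -/
def sgn (a : ZMod 2) : ℤ := if a = 0 then 1 else -1

lemma sgn_add : ∀ a b : ZMod 2, sgn (a + b) = sgn a * sgn b := by decide

lemma sgn_injective : Function.Injective sgn := by unfold Function.Injective; decide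

lemma sgn_mul_self : ∀ a : ZMod 2, sgn a * sgn a = 1 := by decide

variable {n : ℕ} {v : Fin n ≃ V} {ι : Fin n → MulAut (RAAG G)}

/-- The product of the inversions over the nonzero coordinates of `s`. -/
def invProd (ι : Fin n → MulAut (RAAG G)) (s : Fin n → ZMod 2) : MulAut (RAAG G) :=
  (List.ofFn fun j => ι j ^ (s j).val).prod

lemma pow_val_gen_self {f : MulAut (RAAG G)} {w : V} (hf : IsInversion G f w) (a : ZMod 2) :
    (f ^ a.val) (gen G w) = gen G w ^ sgn a := by
  fin_cases a
  · have h0 : (f ^ 0) (gen G w) = gen G w ^ (1 : ℤ) := by simp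
    exact h0
  · have h1 : (f ^ 1) (gen G w) = gen G w ^ (-1 : ℤ) := by simp [hf.1]
    exact h1

lemma pow_val_gen_of_ne {f : MulAut (RAAG G)} {w x : V} (hf : IsInversion G f w) (hx : x ≠ w)
    (a : ZMod 2) : (f ^ a.val) (gen G x) = gen G x := by
  fin_cases a
  · have h0 : (f ^ 0) (gen G x) = gen G x := by simp
    exact h0
  · have h1 : (f ^ 1) (gen G x) = gen G x := by simp [hf.2 x hx]
    exact h1

lemma invProd_gen (hι : ∀ k, IsInversion G (ι k) (v k)) (s : Fin n → ZMod 2) (k : Fin n) :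
    invProd ι s (gen G (v k)) = gen G (v k) ^ sgn (s k) := by
  have main : ∀ l : List (Fin n), l.Nodup → (l.map fun j => ι j ^ (s j).val).prod (gen G (v k)) =
      if k ∈ l then gen G (v k) ^ sgn (s k) else gen G (v k) := by
    intro l hl
    induction l with
    | nil => simp
    | cons j t ih =>
      rw [List.nodup_cons] at hl
      rw [List.map_cons, List.prod_cons, MulAut.mul_apply, ih hl.2]
      by_cases hj : k = j
      · subst hj
        simp [hl.1, pow_val_gen_self (hι k)]
      · have hne : v k ≠ v j := fun e => hj (v.injective e)
        by_cases hk : k ∈ t <;> simp [hk, hj, pow_val_gen_of_ne (hι j) hne]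
  have := main (List.finRange n) (List.nodup_finRange n)
  rwa [if_pos (List.mem_finRange k), ← List.ofFn_eq_map] at this

lemma mulAut_ext_equiv (v : Fin n ≃ V) {f g : MulAut (RAAG G)}
    (h : ∀ k, f (gen G (v k)) = g (gen G (v k))) : f = g :=
  mulAut_ext fun w => by simpa using h (v.symm w)

/-- `invProd` as a homomorphism. -/
def invHom (hι : ∀ k, IsInversion G (ι k) (v k)) :
    Multiplicative (Fin n → ZMod 2) →* MulAut (RAAG G) :=
  MonoidHom.mk' (fun s => invProd ι s.toAdd) fun s t => mulAut_ext_equiv v fun k => by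
    rw [MulAut.mul_apply, invProd_gen hι, invProd_gen hι, map_zpow, invProd_gen hι, ← zpow_mul,
      toAdd_mul, Pi.add_apply, sgn_add]

lemma invProd_add (hι : ∀ k, IsInversion G (ι k) (v k)) (s t : Fin n → ZMod 2) :
    invProd ι (s + t) = invProd ι s * invProd ι t :=
  map_mul (invHom hι) (Multiplicative.ofAdd s) (Multiplicative.ofAdd t)

lemma invProd_zero : invProd ι 0 = 1 := by simp [invProd]

lemma invProd_mul_self (hι : ∀ k, IsInversion G (ι k) (v k)) (s : Fin n → ZMod 2) :
    invProd ι s * invProd ι s = 1 := by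
  have : s + s = 0 := funext fun k => CharTwo.add_self_eq_zero (s k)
  rw [← invProd_add hι, this, invProd_zero]

lemma invProd_single (hι : ∀ k, IsInversion G (ι k) (v k)) (k : Fin n) :
    invProd ι (Pi.single k 1) = ι k := by
  refine mulAut_ext_equiv v fun j => ?_
  rw [invProd_gen hι]
  by_cases h : j = k
  · subst h
    simp [(hι j).1, sgn]
  · simp [(hι k).2 (v j) (fun e => h (v.injective e)), sgn, h]

lemma commute_invProd_conj (hι : ∀ k, IsInversion G (ι k) (v k)) {s : Fin n → ZMod 2} {k : Fin n}
    (hs : s k = 0) : Commute (invProd ι s) (MulAut.conj (gen G (v k))) := by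
  rw [Commute, SemiconjBy, mul_conj, invProd_gen hι, hs, sgn, if_pos rfl, zpow_one]

lemma map_invProd {H : Type*} [Group H] {f g : MulAut (RAAG G) →* H}
    (h : ∀ k, f (ι k) = g (ι k)) (s : Fin n → ZMod 2) :
    f (invProd ι s) = g (invProd ι s) := by
  simp only [invProd, map_list_prod, List.map_ofFn, Function.comp_def, map_pow, h]

/-- Every automorphism is the product of an inner automorphism and inversions. -/
lemma exists_conj_mul_invProd [Fintype V] (hA : Austere G)
    (hι : ∀ k, IsInversion G (ι k) (v k)) (f : MulAut (RAAG G)) :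
    ∃ g s, f = MulAut.conj g * invProd ι s := by
  obtain ⟨h0, h1⟩ := deg_mulAut hA f
  let s : Fin n → ZMod 2 := fun k => if deg (v k) (f (gen G (v k))) = 1 then 0 else 1
  have hs : ∀ k, sgn (s k) = deg (v k) (f (gen G (v k))) := by
    intro k
    rcases h1 (v k) with h | h <;> simp [s, sgn, h]
  obtain ⟨g, hg⟩ := exists_eq_conj hA (f * invProd ι s) (by
    intro x w
    obtain ⟨k, rfl⟩ := v.surjective x
    rw [MulAut.mul_apply, invProd_gen hι, map_zpow, deg_zpow]
    by_cases hw : w = v k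
    · subst hw
      rw [← hs, sgn_mul_self, deg_gen_self]
    · rw [h0 _ _ hw, mul_zero, deg_gen_of_ne (Ne.symm hw)])
  exact ⟨g, s, by rw [← hg, mul_assoc, invProd_mul_self hι, mul_one]⟩

lemma mulAut_hom_ext [Fintype V] (hA : Austere G) (hι : ∀ k, IsInversion G (ι k) (v k))
    {H : Type*} [Group H] {f g : MulAut (RAAG G) →* H}
    (h1 : ∀ k, f (MulAut.conj (gen G (v k))) = g (MulAut.conj (gen G (v k))))
    (h2 : ∀ k, f (ι k) = g (ι k)) : f = g := by
  have hc : f.comp MulAut.conj = g.comp MulAut.conj :=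
    hom_ext fun w => by simpa using h1 (v.symm w)
  ext a
  obtain ⟨b, s, rfl⟩ := exists_conj_mul_invProd hA hι a
  rw [map_mul, map_mul, map_invProd h2]
  exact congrArg (· * _) (DFunLike.congr_fun hc b)

/-! ### The twisting automorphisms -/

/-- The homomorphism sending each generator to its conjugation twisted by inversions. -/
def twist (hι : ∀ k, IsInversion G (ι k) (v k)) {φ : Fin n → Fin n → ZMod 2}
    (hφ : cond15 G v φ) : RAAG G →* MulAut (RAAG G) :=
  lift (fun w => MulAut.conj (gen G w) * invProd ι (φ (v.symm w))) (by
    have key : ∀ u w, G.Adj u w →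
        Commute (MulAut.conj (gen G u)) (invProd ι (φ (v.symm w))) := by
      intro u w huw
      have := commute_invProd_conj hι (s := φ (v.symm w)) (k := v.symm u)
        (hφ.2 _ _ (by simpa using huw.symm))
      simpa using this.symm
    intro u w huw
    refine Commute.mul_left (Commute.mul_right ?_ (key u w huw))
      (Commute.mul_right (key w u huw.symm).symm ?_)
    · exact (gen_commute huw).map MulAut.conj
    · exact (Commute.all (Multiplicative.ofAdd (φ (v.symm u)))
        (Multiplicative.ofAdd (φ (v.symm w)))).map (invHom hι))

lemma twist_gen (hι : ∀ k, IsInversion G (ι k) (v k)) {φ : Fin n → Fin n → ZMod 2}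
    (hφ : cond15 G v φ) (k : Fin n) :
    twist hι hφ (gen G (v k)) = MulAut.conj (gen G (v k)) * invProd ι (φ k) := by
  simp [twist]

lemma twist_invProd (hι : ∀ k, IsInversion G (ι k) (v k)) {φ : Fin n → Fin n → ZMod 2}
    (hφ : cond15 G v φ) (s : Fin n → ZMod 2) (k : Fin n) :
    twist hι hφ (invProd ι s (gen G (v k))) =
      invProd ι s * twist hι hφ (gen G (v k)) * (invProd ι s)⁻¹ := by
  have hc : Commute (invProd ι s) (invProd ι (φ k)) :=
    (Commute.all (Multiplicative.ofAdd s) (Multiplicative.ofAdd (φ k))).map (invHom hι)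
  have hk := commute_invProd_conj hι (hφ.1 k)
  rw [twist_gen, ← mul_assoc, mul_conj, mul_assoc _ (invProd ι s), hc.eq, ← mul_assoc,
    mul_inv_cancel_right, invProd_gen hι, map_zpow, map_zpow, twist_gen, hk.symm.mul_zpow]
  congr 1
  unfold sgn
  split_ifs
  · rw [zpow_one]
  · rw [zpow_neg_one]
    exact inv_eq_of_mul_eq_one_left (invProd_mul_self hι _)

/-- The homomorphism from the semidirect product of `RAAG G` with the sign group to the
automorphism group, twisted by `φ`. -/
def twistedHom (hι : ∀ k, IsInversion G (ι k) (v k)) {φ : Fin n → Fin n → ZMod 2}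
    (hφ : cond15 G v φ) :
    RAAG G ⋊[invHom hι] Multiplicative (Fin n → ZMod 2) →* MulAut (RAAG G) :=
  SemidirectProduct.lift (twist hι hφ) (invHom hι) fun s => hom_ext fun w => by
    have := twist_invProd hι hφ s.toAdd (v.symm w)
    rw [Equiv.apply_symm_apply] at this
    exact this

lemma twistedHom_inl (hι : ∀ k, IsInversion G (ι k) (v k)) {φ : Fin n → Fin n → ZMod 2}
    (hφ : cond15 G v φ) (g : RAAG G) :
    twistedHom hι hφ (SemidirectProduct.inl g) = twist hι hφ g :=
  SemidirectProduct.lift_inl _ _ _ _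

lemma cond15_zero : cond15 G v 0 := ⟨fun _ => rfl, fun _ _ _ => rfl⟩

lemma twist_zero (hι : ∀ k, IsInversion G (ι k) (v k)) :
    twist hι (cond15_zero (G := G) (v := v)) = MulAut.conj := hom_ext fun w => by
  obtain ⟨k, rfl⟩ := v.surjective w
  rw [twist_gen, Pi.zero_apply, invProd_zero, mul_one]

lemma twistedHom_zero_bijective [Fintype V] (hA : Austere G)
    (hι : ∀ k, IsInversion G (ι k) (v k)) :
    Function.Bijective (twistedHom hι (cond15_zero (G := G) (v := v))) := by
  have happ : ∀ x, twistedHom hι (cond15_zero (G := G) (v := v)) x =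
      MulAut.conj x.left * invProd ι x.right.toAdd := by
    intro x
    rw [← twist_zero hι]
    rfl
  constructor
  · refine (injective_iff_map_eq_one _).2 fun x hx => ?_
    rw [happ] at hx
    have hr : x.right.toAdd = 0 := by
      funext k
      have := congrArg (deg (v k)) (DFunLike.congr_fun hx (gen G (v k)))
      rw [MulAut.mul_apply, invProd_gen hι, MulAut.conj_apply, MulAut.one_apply] at this
      simp only [deg_mul, deg_zpow, deg_inv, deg_gen_self] at this
      refine sgn_injective (?_ : _ = (1 : ℤ))
      linarith
    rw [hr, invProd_zero, mul_one] at hx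
    exact SemidirectProduct.ext (conj_injective hA (hx.trans (map_one _).symm)) hr
  · intro f
    obtain ⟨g, s, rfl⟩ := exists_conj_mul_invProd hA hι f
    exact ⟨⟨g, Multiplicative.ofAdd s⟩, happ _⟩

lemma map_invProd_eq {f : MulAut (RAAG G) →* MulAut (RAAG G)} (h : ∀ k, f (ι k) = ι k)
    (s : Fin n → ZMod 2) : f (invProd ι s) = invProd ι s :=
  map_invProd (g := MonoidHom.id _) h s

lemma comp_self_eq_id [Fintype V] (hA : Austere G) (hι : ∀ k, IsInversion G (ι k) (v k))
    {φ : Fin n → Fin n → ZMod 2} {f : MulAut (RAAG G) →* MulAut (RAAG G)}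
    (h1 : ∀ k, f (MulAut.conj (gen G (v k))) = MulAut.conj (gen G (v k)) * invProd ι (φ k))
    (h2 : ∀ k, f (ι k) = ι k) : f.comp f = MonoidHom.id _ := by
  refine mulAut_hom_ext hA hι (fun k => ?_) (fun k => ?_)
  · rw [MonoidHom.comp_apply, h1, map_mul, h1, map_invProd_eq h2, mul_assoc,
      invProd_mul_self hι, mul_one, MonoidHom.id_apply]
  · rw [MonoidHom.comp_apply, h2, h2, MonoidHom.id_apply]

lemma exists_prop15 [Fintype V] (hA : Austere G) (hι : ∀ k, IsInversion G (ι k) (v k))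
    {φ : Fin n → Fin n → ZMod 2} (hφ : cond15 G v φ) : ∃ Φ, prop15 G v ι φ Φ := by
  let e := MulEquiv.ofBijective _ (twistedHom_zero_bijective hA hι)
  let f : MulAut (RAAG G) →* MulAut (RAAG G) := (twistedHom hι hφ).comp e.symm.toMonoidHom
  have h1 : ∀ k, f (MulAut.conj (gen G (v k))) =
      MulAut.conj (gen G (v k)) * invProd ι (φ k) := by
    intro k
    have : e (SemidirectProduct.inl (gen G (v k))) = MulAut.conj (gen G (v k)) := by
      rw [← twist_zero hι]
      exact twistedHom_inl hι cond15_zero _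
    rw [← twist_gen hι hφ]
    change twistedHom hι hφ (e.symm _) = _
    rw [← this, e.symm_apply_apply, twistedHom_inl]
  have h2 : ∀ k, f (ι k) = ι k := by
    intro k
    have h : ∀ ψ (hψ : cond15 G v ψ), twistedHom hι hψ
        (SemidirectProduct.inr (Multiplicative.ofAdd (Pi.single k 1))) = ι k := fun ψ hψ =>
      (SemidirectProduct.lift_inr _ _ _ _).trans (invProd_single hι k)
    change twistedHom hι hφ (e.symm _) = _
    have h3 : e (SemidirectProduct.inr (Multiplicative.ofAdd (Pi.single k 1))) = ι k :=
      h 0 cond15_zero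
    conv_lhs => rw [← h3]
    rw [e.symm_apply_apply, h φ hφ]
  have hf := comp_self_eq_id hA hι h1 h2
  exact ⟨f.toMulEquiv f hf hf, fun k => ⟨h1 k, h2 k⟩⟩

lemma prop15_unique [Fintype V] (hA : Austere G) (hι : ∀ k, IsInversion G (ι k) (v k))
    {φ : Fin n → Fin n → ZMod 2} {Φ Ψ : MulAut (MulAut (RAAG G))} (hΦ : prop15 G v ι φ Φ)
    (hΨ : prop15 G v ι φ Ψ) : Φ = Ψ :=
  MulEquiv.toMonoidHom_injective (mulAut_hom_ext hA hι
    (fun k => (hΦ k).1.trans (hΨ k).1.symm) fun k => (hΦ k).2.trans (hΨ k).2.symm)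

lemma mul_self_of_prop15 [Fintype V] (hA : Austere G) (hι : ∀ k, IsInversion G (ι k) (v k))
    {φ : Fin n → Fin n → ZMod 2} {Φ : MulAut (MulAut (RAAG G))} (hΦ : prop15 G v ι φ Φ) :
    Φ * Φ = 1 :=
  MulEquiv.toMonoidHom_injective (comp_self_eq_id (f := Φ.toMonoidHom) hA hι
    (fun k => (hΦ k).1) fun k => (hΦ k).2)

lemma eq_of_mk_eq (hι : ∀ k, IsInversion G (ι k) (v k)) {φ ψ : Fin n → Fin n → ZMod 2}
    {Φ Ψ : MulAut (MulAut (RAAG G))} (hΦ : prop15 G v ι φ Φ) (hΨ : prop15 G v ι ψ Ψ)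
    (h : QuotientGroup.mk' (Inn (MulAut (RAAG G))) Φ =
      QuotientGroup.mk' (Inn (MulAut (RAAG G))) Ψ) : φ = ψ := by
  obtain ⟨a, ha⟩ := QuotientGroup.eq.1 h
  have hΨ' : ∀ b, Ψ b = Φ a * Φ b * (Φ a)⁻¹ := by
    intro b
    have : Ψ = Φ * MulAut.conj a := by rw [ha, mul_inv_cancel_left]
    rw [this, MulAut.mul_apply, MulAut.conj_apply, map_mul, map_mul, map_inv]
  have hfix : ∀ k, (MulAut.conj (Φ a)).toMonoidHom (ι k) = ι k := by
    intro k
    have := hΨ' (ι k)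
    rw [(hΨ k).2, (hΦ k).2] at this
    exact this.symm
  funext k j
  have h1 : MulAut.conj (gen G (v k)) * invProd ι (ψ k) =
      MulAut.conj (Φ a (gen G (v k))) * invProd ι (φ k) := by
    have e1 : Ψ _ = _ * invProd ι (ψ k) := (hΨ k).1
    have e2 : Φ _ = _ * invProd ι (φ k) := (hΦ k).1
    have e3 : Φ a * invProd ι (φ k) * (Φ a)⁻¹ = invProd ι (φ k) := map_invProd_eq hfix (φ k)
    rw [← e1, hΨ', e2, ← mul_assoc, mul_conj, mul_assoc _ (Φ a), mul_assoc, e3]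
  have h2 := congrArg (deg (v j)) (DFunLike.congr_fun h1 (gen G (v j)))
  rw [MulAut.mul_apply, MulAut.mul_apply, invProd_gen hι, invProd_gen hι, MulAut.conj_apply,
    MulAut.conj_apply] at h2
  simp only [deg_mul, deg_zpow, deg_inv, deg_gen_self] at h2
  refine sgn_injective ?_
  linarith

lemma prop15_one : prop15 G v ι 0 1 := fun k => ⟨by
  have : invProd ι ((0 : Fin n → Fin n → ZMod 2) k) = 1 := invProd_zero
  change _ = _ * invProd ι ((0 : Fin n → Fin n → ZMod 2) k)
  rw [this, mul_one, MulAut.one_apply], rfl⟩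

end Raag

/-- For an austere graph, each admissible `φ` induces a unique automorphism `Φ_φ` of
`Aut(A_Γ)`; each `Φ_φ` is an involution, is non-inner when `φ ≠ 0`, and the induced map
`φ ↦ [Φ_φ] ∈ Out(Aut(A_Γ))` is injective. -/
theorem stmt15 {V : Type} [Fintype V] (G : SimpleGraph V) (hA : Austere G)
    {n : ℕ} (hn : 1 < n) (v : Fin n ≃ V)
    (ι : Fin n → MulAut (RAAG G)) (hι : ∀ k, IsInversion G (ι k) (v k)) :
    (∀ φ : Fin n → Fin n → ZMod 2, cond15 G v φ →
      ∃! Φ : MulAut (MulAut (RAAG G)), prop15 G v ι φ Φ) ∧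
    (∀ φ : Fin n → Fin n → ZMod 2, cond15 G v φ →
      ∀ Φ : MulAut (MulAut (RAAG G)), prop15 G v ι φ Φ →
        Φ * Φ = 1 ∧ (φ ≠ 0 → Φ ∉ Inn (MulAut (RAAG G)))) ∧
    (∀ φ ψ : Fin n → Fin n → ZMod 2, cond15 G v φ → cond15 G v ψ →
      ∀ Φ Ψ : MulAut (MulAut (RAAG G)), prop15 G v ι φ Φ → prop15 G v ι ψ Ψ →
        QuotientGroup.mk' (Inn (MulAut (RAAG G))) Φ =
          QuotientGroup.mk' (Inn (MulAut (RAAG G))) Ψ → φ = ψ) := by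
  refine ⟨fun φ hφ => ?_, fun φ _ Φ hΦ => ⟨Raag.mul_self_of_prop15 hA hι hΦ, fun h0 hin => ?_⟩,
    fun φ ψ _ _ Φ Ψ hΦ hΨ h => Raag.eq_of_mk_eq hι hΦ hΨ h⟩
  · obtain ⟨Φ, hΦ⟩ := Raag.exists_prop15 hA hι hφ
    exact ⟨Φ, hΦ, fun Ψ hΨ => Raag.prop15_unique hA hι hΨ hΦ⟩
  · refine h0 (Raag.eq_of_mk_eq hι hΦ Raag.prop15_one ?_)
    rw [map_one]
    exact (QuotientGroup.eq_one_iff Φ).2 hin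
end
end

section
/- If Γ is an austere finite simplicial graph with n > 1 vertices in which every vertex has degree at most d, where n − d − 1 ≥ 0, then the group Out(Aut(A_Γ)) has cardinality at least 2^{n(n−d−1)}. -/
noncomputable section

namespace RAAG

section Basic

variable {V : Type} {G : SimpleGraph V}

theorem mem_star_iff {v w : V} : w ∈ _root_.star G v ↔ w = v ∨ G.Adj v w := Iff.rfl

theorem commute_gen {u v : V} (h : G.Adj u v) : Commute (gen G u) (gen G v) := by
  have : PresentedGroup.mk (raagRels G) (FreeGroup.of u * FreeGroup.of v * (FreeGroup.of u)⁻¹ *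
      (FreeGroup.of v)⁻¹) = 1 := PresentedGroup.one_of_mem ⟨u, v, h, rfl⟩
  simp only [map_mul, map_inv] at this
  exact mul_inv_eq_iff_eq_mul.mp (mul_inv_eq_one.mp this)

/-- The universal property of a right-angled Artin group. -/
def lift {H : Type*} [Group H] (f : V → H) (hf : ∀ u v, G.Adj u v → Commute (f u) (f v)) :
    RAAG G →* H :=
  PresentedGroup.toGroup (f := f) <| by
    rintro _ ⟨u, v, h, rfl⟩
    simp [(hf u v h).eq]

@[simp]
theorem lift_gen {H : Type*} [Group H] (f : V → H) (hf : ∀ u v, G.Adj u v → Commute (f u) (f v))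
    (v : V) : lift f hf (gen G v) = f v :=
  PresentedGroup.toGroup.of _

theorem hom_ext {H : Type*} [Group H] {f g : RAAG G →* H}
    (h : ∀ v, f (gen G v) = g (gen G v)) : f = g :=
  PresentedGroup.ext h

open Classical in
/-- The exponent sum of the generator `w`, as a homomorphism. -/
def exHom (G : SimpleGraph V) (w : V) : RAAG G →* Multiplicative ℤ :=
  lift (fun u => if u = w then Multiplicative.ofAdd 1 else 1) fun _ _ _ => Commute.all _ _

/-- The exponent sum of the generator `w`. -/
def ex (w : V) (g : RAAG G) : ℤ := (exHom G w g).toAdd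

@[simp] theorem ex_one (w : V) : ex w (1 : RAAG G) = 0 := by simp [ex]

@[simp] theorem ex_mul (w : V) (g h : RAAG G) : ex w (g * h) = ex w g + ex w h := by simp [ex]

@[simp] theorem ex_inv (w : V) (g : RAAG G) : ex w g⁻¹ = -ex w g := by simp [ex]

@[simp] theorem ex_pow (w : V) (g : RAAG G) (n : ℕ) : ex w (g ^ n) = n * ex w g := by simp [ex]

@[simp] theorem ex_zpow (w : V) (g : RAAG G) (n : ℤ) : ex w (g ^ n) = n * ex w g := by simp [ex]

open Classical in
theorem ex_gen (w u : V) : ex w (gen G u) = if u = w then 1 else 0 := by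
  simp only [ex, exHom, lift_gen]
  split_ifs <;> rfl

@[simp] theorem ex_gen_self (w : V) : ex w (gen G w) = 1 := by simp [ex_gen]

theorem ex_gen_of_ne {w u : V} (h : u ≠ w) : ex w (gen G u) = 0 := by simp [ex_gen, h]

/-- The integral Heisenberg group. -/
@[ext]
structure Heisenberg where
  /-- the first coordinate -/
  x : ℤ
  /-- the second coordinate -/
  y : ℤ
  /-- the central coordinate -/
  z : ℤ

instance : Mul Heisenberg := ⟨fun a b => ⟨a.x + b.x, a.y + b.y, a.z + b.z + a.x * b.y⟩⟩
instance : One Heisenberg := ⟨⟨0, 0, 0⟩⟩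
instance : Inv Heisenberg := ⟨fun a => ⟨-a.x, -a.y, -a.z + a.x * a.y⟩⟩

theorem Heisenberg.mul_def (a b : Heisenberg) :
    a * b = ⟨a.x + b.x, a.y + b.y, a.z + b.z + a.x * b.y⟩ := rfl

theorem Heisenberg.one_def : (1 : Heisenberg) = ⟨0, 0, 0⟩ := rfl

theorem Heisenberg.inv_def (a : Heisenberg) : a⁻¹ = ⟨-a.x, -a.y, -a.z + a.x * a.y⟩ := rfl

instance : Group Heisenberg :=
  Group.ofLeftAxioms
    (fun a b c => by simp only [Heisenberg.mul_def, Heisenberg.mk.injEq]; refine ⟨?_, ?_, ?_⟩ <;> ring)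
    (fun a => by simp [Heisenberg.mul_def, Heisenberg.one_def])
    (fun a => by simp [Heisenberg.mul_def, Heisenberg.one_def, Heisenberg.inv_def])

/-- The first coordinate of the Heisenberg group, as a homomorphism. -/
def Heisenberg.xHom : Heisenberg →* Multiplicative ℤ where
  toFun a := Multiplicative.ofAdd a.x
  map_one' := rfl
  map_mul' _ _ := rfl

/-- The second coordinate of the Heisenberg group, as a homomorphism. -/
def Heisenberg.yHom : Heisenberg →* Multiplicative ℤ where
  toFun a := Multiplicative.ofAdd a.y
  map_one' := rfl
  map_mul' _ _ := rfl

open Classical in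
/-- The exponent vectors of two commuting elements are proportional on each pair of
nonadjacent vertices. -/
theorem ex_mul_ex_of_commute {g h : RAAG G} (hgh : Commute g h) {i j : V} (hij : ¬G.Adj i j) :
    ex i g * ex j h = ex j g * ex i h := by
  rcases eq_or_ne i j with rfl | hne
  · rfl
  let f : V → Heisenberg := fun u => if u = i then ⟨1, 0, 0⟩ else if u = j then ⟨0, 1, 0⟩ else 1
  have hf : ∀ u v, G.Adj u v → Commute (f u) (f v) := by
    intro u v huv
    have huv' := huv.ne
    have hji : ¬G.Adj j i := fun h => hij h.symm
    by_cases h1 : u = i <;> by_cases h2 : u = j <;> by_cases h3 : v = i <;> by_cases h4 : v = j <;>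
      simp_all [f]
  have hx : Heisenberg.xHom.comp (lift f hf) = exHom G i := by
    refine hom_ext fun u => ?_
    by_cases h1 : u = i <;> by_cases h2 : u = j <;>
      simp_all [f, exHom, Heisenberg.xHom, Heisenberg.one_def]
  have hy : Heisenberg.yHom.comp (lift f hf) = exHom G j := by
    refine hom_ext fun u => ?_
    by_cases h1 : u = i <;> by_cases h2 : u = j <;>
      simp_all [f, exHom, Heisenberg.yHom, Heisenberg.one_def]
  have hx' : ∀ g, (lift f hf g).x = ex i g := fun g =>
    congrArg Multiplicative.toAdd (DFunLike.congr_fun hx g)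
  have hy' : ∀ g, (lift f hf g).y = ex j g := fun g =>
    congrArg Multiplicative.toAdd (DFunLike.congr_fun hy g)
  have hz := congrArg Heisenberg.z (hgh.map (lift f hf)).eq
  simp only [Heisenberg.mul_def, hx', hy'] at hz
  linarith

open Classical in
/-- The retraction of a right-angled Artin group onto the subgroup generated by `T`. -/
def ret (G : SimpleGraph V) (T : Set V) : RAAG G →* RAAG G :=
  lift (fun v => if v ∈ T then gen G v else 1) fun u v h => by
    by_cases hu : u ∈ T <;> by_cases hv : v ∈ T <;> simp [hu, hv, commute_gen h]

theorem ret_gen_of_mem {T : Set V} {v : V} (h : v ∈ T) : ret G T (gen G v) = gen G v := by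
  simp [ret, h]

theorem ret_gen_of_notMem {T : Set V} {v : V} (h : v ∉ T) : ret G T (gen G v) = 1 := by
  simp [ret, h]

theorem ret_ret (S T : Set V) (g : RAAG G) : ret G S (ret G T g) = ret G (S ∩ T) g := by
  have : (ret G S).comp (ret G T) = ret G (S ∩ T) := by
    refine hom_ext fun v => ?_
    by_cases hS : v ∈ S <;> by_cases hT : v ∈ T <;> simp [ret, hS, hT]
  exact DFunLike.congr_fun this g

theorem ret_comm (S T : Set V) (g : RAAG G) : ret G S (ret G T g) = ret G T (ret G S g) := by
  rw [ret_ret, ret_ret, Set.inter_comm]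

theorem ret_univ (g : RAAG G) : ret G Set.univ g = g := by
  have : ret G Set.univ = MonoidHom.id _ := hom_ext fun v => by simp [ret]
  exact DFunLike.congr_fun this g

theorem ret_empty (g : RAAG G) : ret G ∅ g = 1 := by
  have : ret G ∅ = 1 := hom_ext fun v => by simp [ret]
  exact DFunLike.congr_fun this g

theorem ret_singleton (w : V) (g : RAAG G) : ret G {w} g = gen G w ^ ex w g := by
  have : ret G {w} = (zpowersHom _ (gen G w)).comp (exHom G w) := by
    refine hom_ext fun v => ?_
    by_cases h : v = w <;> simp [ret, exHom, h]
  exact DFunLike.congr_fun this g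

theorem ex_ret_of_mem {T : Set V} {w : V} (h : w ∈ T) (g : RAAG G) :
    ex w (ret G T g) = ex w g := by
  have : (exHom G w).comp (ret G T) = exHom G w := by
    refine hom_ext fun v => ?_
    by_cases hv : v ∈ T
    · simp [ret_gen_of_mem hv]
    · have : v ≠ w := fun e => hv (e ▸ h)
      simp [ret_gen_of_notMem hv, exHom, this]
  exact congrArg Multiplicative.toAdd (DFunLike.congr_fun this g)

theorem ret_compl_of_forall (T : Finset V) {g : RAAG G} (h : ∀ t ∈ T, ret G {t}ᶜ g = g) :
    ret G (T : Set V)ᶜ g = g := by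
  classical
  induction T using Finset.induction_on with
  | empty => simpa using ret_univ g
  | insert t T _ ih =>
    have : (↑(insert t T) : Set V)ᶜ = {t}ᶜ ∩ (T : Set V)ᶜ := by
      ext; simp
    rw [this, ← ret_ret, ih fun s hs => h s (Finset.mem_insert_of_mem hs),
      h t (Finset.mem_insert_self _ _)]

end Basic

section FreeGroupAction

open SemidirectProduct

variable {Q B : Type*} [Group B] [MulAction B Q]

/-- The action of `B` on the free group on a `B`-set `Q` by permuting the basis. -/
def basisAct : B →* MulAut (FreeGroup Q) where
  toFun b := FreeGroup.freeGroupCongr (MulAction.toPerm b)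
  map_one' := by
    ext f
    induction f using FreeGroup.induction_on <;> simp_all [FreeGroup.freeGroupCongr]
  map_mul' a b := by
    ext f
    induction f using FreeGroup.induction_on <;> simp_all [FreeGroup.freeGroupCongr, mul_smul]

@[simp]
theorem basisAct_of (b : B) (x : Q) :
    basisAct b (FreeGroup.of x) = FreeGroup.of (b • x) := by
  simp [basisAct, FreeGroup.freeGroupCongr]

open Classical in
/-- The endomorphism of a free group killing the basis elements outside `S`. -/
def proj (S : Set Q) : FreeGroup Q →* FreeGroup Q :=
  FreeGroup.lift fun x => if x ∈ S then FreeGroup.of x else 1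

theorem proj_of_mem {S : Set Q} {x : Q} (h : x ∈ S) :
    proj S (FreeGroup.of x) = FreeGroup.of x := by simp [proj, h]

theorem proj_of_notMem {S : Set Q} {x : Q} (h : x ∉ S) : proj S (FreeGroup.of x) = 1 := by
  simp [proj, h]

theorem exists_finite_proj_eq (f : FreeGroup Q) :
    ∃ E : Set Q, E.Finite ∧ ∀ S, E ⊆ S → proj S f = f := by
  induction f using FreeGroup.induction_on with
  | C1 => exact ⟨∅, Set.finite_empty, fun S _ => map_one _⟩
  | of x =>
    exact ⟨{x}, Set.finite_singleton x, fun S hS => proj_of_mem (hS rfl)⟩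
  | inv_of x ih =>
    obtain ⟨E, hE, h⟩ := ih
    exact ⟨E, hE, fun S hS => by rw [map_inv, h S hS]⟩
  | mul x y hx hy =>
    obtain ⟨E, hE, h⟩ := hx
    obtain ⟨E', hE', h'⟩ := hy
    exact ⟨E ∪ E', hE.union hE', fun S hS => by
      rw [map_mul, h S (Set.subset_union_left.trans hS), h' S (Set.subset_union_right.trans hS)]⟩

theorem proj_basisAct {S : Set Q} {b : B} (hS : ∀ x, b • x ∈ S ↔ x ∈ S) (f : FreeGroup Q) :
    proj S (basisAct b f) = basisAct b (proj S f) := by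
  have : (proj S).comp (basisAct b).toMonoidHom = (basisAct b).toMonoidHom.comp (proj S) := by
    refine FreeGroup.ext_hom _ _ fun x => ?_
    by_cases hx : x ∈ S
    · simp [proj_of_mem hx, proj_of_mem ((hS x).2 hx)]
    · simp [proj_of_notMem hx, proj_of_notMem (mt (hS x).1 hx)]
  exact DFunLike.congr_fun this f

theorem proj_basisAct_eq_one {E S : Set Q} {b : B} (h : ∀ x ∈ E, b • x ∉ S) {f : FreeGroup Q}
    (hf : proj E f = f) : proj S (basisAct b f) = 1 := by
  have : ((proj S).comp (basisAct b).toMonoidHom).comp (proj E) = 1 := by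
    refine FreeGroup.ext_hom _ _ fun x => ?_
    by_cases hx : x ∈ E
    · simp [proj_of_mem hx, proj_of_notMem (h x hx)]
    · simp [proj_of_notMem hx]
  have := DFunLike.congr_fun this f
  rwa [MonoidHom.comp_apply, hf] at this

/-- If no nontrivial power of `b` fixes a basis element, then `b` fixes only `1`. -/
theorem eq_one_of_basisAct_eq {b : B} (hb : ∀ (k : ℤ) (x : Q), b ^ k • x = x → k = 0)
    {f : FreeGroup Q} (hf : basisAct b f = f) : f = 1 := by
  obtain ⟨E, hE, hEf⟩ := exists_finite_proj_eq f
  have hfin : (⋃ x ∈ E, ⋃ y ∈ E, {k : ℤ | b ^ k • x = y}).Finite := by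
    refine hE.biUnion fun x _ => hE.biUnion fun y _ => Set.Subsingleton.finite ?_
    intro k hk l hl
    have : b ^ (k - l) • y = y := by
      rw [← (show b ^ l • x = y from hl), ← mul_smul, ← zpow_add, sub_add_cancel]
      exact (show b ^ k • x = y from hk).trans (show b ^ l • x = y from hl).symm
    have := hb _ _ this
    omega
  obtain ⟨k, hk⟩ := hfin.exists_notMem
  simp only [Set.mem_iUnion, not_exists] at hk
  have hkf : basisAct (b ^ k) f = f := by
    have : basisAct b ∈ MulAction.stabilizer (MulAut (FreeGroup Q)) f := hf
    rw [map_zpow]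
    exact zpow_mem this k
  rw [← hEf E subset_rfl, ← hkf]
  exact proj_basisAct_eq_one (fun x hx hy => hk x hx _ hy rfl) (hEf E subset_rfl)

/-- The action of `F(Q) ⋊ B` on (the vertices of the Cayley tree of) `F(Q)`. -/
def move (s : FreeGroup Q ⋊[basisAct] B) (p : FreeGroup Q) : FreeGroup Q :=
  s.left * basisAct s.right p

theorem move_mul (s t : FreeGroup Q ⋊[basisAct] B) (p : FreeGroup Q) :
    move (s * t) p = move s (move t p) := by
  simp [move, mul_assoc]

theorem move_inr_one (b : B) : move (inr b : FreeGroup Q ⋊[basisAct] B) 1 = 1 := by simp [move]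

theorem move_inl_one (p : FreeGroup Q) : move (inl p : FreeGroup Q ⋊[basisAct] B) 1 = p := by
  simp [move]

theorem move_inv_eq_iff (s : FreeGroup Q ⋊[basisAct] B) (p q : FreeGroup Q) :
    move s⁻¹ p = q ↔ p = move s q := by
  have h1 : ∀ p, move (1 : FreeGroup Q ⋊[basisAct] B) p = p := fun p => by simp [move]
  constructor
  · rintro rfl
    rw [← move_mul, mul_inv_cancel, h1]
  · rintro rfl
    rw [← move_mul, inv_mul_cancel, h1]

/-- Fixed points are unique if no nontrivial power of the linear part fixes a basis element. -/
theorem move_fixed_unique {s : FreeGroup Q ⋊[basisAct] B}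
    (hs : ∀ (k : ℤ) (x : Q), s.right ^ k • x = x → k = 0) {p q : FreeGroup Q}
    (hp : move s p = p) (hq : move s q = q) : p = q := by
  have : basisAct s.right (p⁻¹ * q) = p⁻¹ * q := by
    rw [move, ← eq_inv_mul_iff_mul_eq] at hp hq
    rw [map_mul, map_inv, hp, hq]
    group
  exact inv_mul_eq_one.mp (eq_one_of_basisAct_eq hs this)

/-- If `s` and `t` commute and the elements `t ^ k * s ^ i` with `k ≠ 0` fix no basis element,
then `s` has a fixed point. -/
theorem exists_move_fixed {s t : FreeGroup Q ⋊[basisAct] B} (hst : Commute s t)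
    (hfree : ∀ (k i : ℤ) (x : Q), (t.right ^ k * s.right ^ i) • x = x → k = 0) :
    ∃ p, move s p = p := by
  obtain ⟨E, hE, hEf⟩ := exists_finite_proj_eq s.left
  have hright : Commute s.right t.right := hst.map rightHom
  have hfin : (⋃ x ∈ E, ⋃ y ∈ E,
      {k : ℤ | ∃ i : ℤ, (t.right ^ k * s.right ^ i) • x = y}).Finite := by
    refine hE.biUnion fun x _ => hE.biUnion fun y _ => Set.Subsingleton.finite ?_
    rintro k ⟨i, hk⟩ l ⟨j, hl⟩
    have : (t.right ^ (k - l) * s.right ^ (i - j)) • y = y := by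
      conv_lhs => rw [← hl]
      rw [← mul_smul, ← hk]
      congr 1
      rw [mul_assoc, ← mul_assoc (s.right ^ (i - j)),
        (hright.zpow_zpow (i - j) l).eq, mul_assoc, ← zpow_add, ← mul_assoc, ← zpow_add,
        sub_add_cancel, sub_add_cancel]
    have := hfree _ _ _ this
    omega
  obtain ⟨k, hk⟩ := hfin.exists_notMem
  simp only [Set.mem_iUnion, not_exists] at hk
  let S : Set Q := {x | ∃ i : ℤ, s.right ^ i • x ∈ E}
  have hES : E ⊆ S := fun x hx => ⟨0, by simpa using hx⟩
  have hS : ∀ x, s.right • x ∈ S ↔ x ∈ S := by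
    refine fun x => ⟨fun ⟨i, hi⟩ => ⟨i + 1, ?_⟩, fun ⟨i, hi⟩ => ⟨i - 1, ?_⟩⟩
    · rwa [zpow_add_one, mul_smul]
    · rwa [← mul_smul, ← zpow_add_one, sub_add_cancel]
  have hkS : ∀ x ∈ E, (t ^ k).right • x ∉ S := by
    rintro x hx ⟨i, hi⟩
    have hr : (t ^ k).right = t.right ^ k := map_zpow rightHom t k
    refine hk x hx _ hi ⟨i, ?_⟩
    rw [← mul_smul, hr, (hright.zpow_zpow i k).eq]
  have hcomm := congrArg (fun z => proj S z.left) (hst.zpow_right k).eq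
  simp only [mul_left, map_mul, proj_basisAct hS, hEf S hES,
    proj_basisAct_eq_one hkS (hEf E subset_rfl), mul_one] at hcomm
  exact ⟨proj S (t ^ k).left, hcomm⟩

end FreeGroupAction

section Tree

open SemidirectProduct

variable {V : Type} {G : SimpleGraph V} {v : V}

/-- The subgroup generated by the vertices other than `v`. -/
def base (G : SimpleGraph V) (v : V) : Subgroup (RAAG G) := (ret G {v}ᶜ).range

theorem mem_base {g : RAAG G} : g ∈ base G v ↔ ret G {v}ᶜ g = g := by
  refine ⟨?_, fun h => ⟨g, h⟩⟩
  rintro ⟨x, rfl⟩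
  rw [ret_ret, Set.inter_self]

/-- The retraction onto `base G v`. -/
def toBase (G : SimpleGraph V) (v : V) : RAAG G →* base G v := (ret G {v}ᶜ).rangeRestrict

theorem coe_toBase (g : RAAG G) : (toBase G v g : RAAG G) = ret G {v}ᶜ g := rfl

theorem toBase_gen_self : toBase G v (gen G v) = 1 :=
  Subtype.ext (ret_gen_of_notMem (by simp))

/-- The positively oriented edges issuing from a vertex of the Bass-Serre tree of the splitting
of `RAAG G` as an HNN extension with stable letter `v`. -/
abbrev Edge (G : SimpleGraph V) (v : V) :=
  base G v ⧸ (Subgroup.centralizer {gen G v}).subgroupOf (base G v)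

/-- The splitting of `RAAG G` as the semidirect product of the free normal subgroup
generated by the conjugates of `v` and of `base G v`. -/
abbrev Splitting (G : SimpleGraph V) (v : V) :=
  FreeGroup (Edge G v) ⋊[basisAct] base G v

theorem commute_inl_inr {N H : Type*} [Group N] [Group H] {φ : H →* MulAut N} {n : N} {h : H}
    (hn : φ h n = n) : Commute (inl n : N ⋊[φ] H) (inr h) := by
  refine SemidirectProduct.ext ?_ ?_ <;> simp [hn]

open Classical in
/-- The isomorphism from `RAAG G` to its splitting, as a homomorphism. -/
def toSplitting (G : SimpleGraph V) (v : V) : RAAG G →* Splitting G v :=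
  lift (fun u => if u = v then inl (FreeGroup.of ((1 : base G v) : Edge G v))
    else inr (toBase G v (gen G u))) <| by
    have key : ∀ w, G.Adj v w → Commute
        (inl (FreeGroup.of ((1 : base G v) : Edge G v)) : Splitting G v)
        (inr (toBase G v (gen G w))) := by
      intro w hw
      refine commute_inl_inr ?_
      rw [basisAct_of]
      congr 1
      refine QuotientGroup.eq.mpr ?_
      rw [Subgroup.mem_subgroupOf, Subgroup.mem_centralizer_singleton_iff]
      have : ((toBase G v (gen G w) • 1)⁻¹ * 1 : base G v) = (toBase G v (gen G w))⁻¹ := by simp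
      rw [this, Subgroup.coe_inv, coe_toBase, ret_gen_of_mem (by simpa using hw.ne')]
      exact (commute_gen hw.symm).inv_left.eq
    intro u w h
    by_cases hu : u = v <;> by_cases hw : w = v
    · exact absurd (hu.trans hw.symm) h.ne
    · subst hu; simpa [hw] using key w h
    · subst hw; simpa [hu] using (key u h.symm).symm
    · simpa [hu, hw] using ((commute_gen h).map (toBase G v)).map inr

theorem toSplitting_gen_self :
    toSplitting G v (gen G v) = inl (FreeGroup.of ((1 : base G v) : Edge G v)) := by
  simp [toSplitting]

theorem toSplitting_gen_of_ne {u : V} (h : u ≠ v) :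
    toSplitting G v (gen G u) = inr (toBase G v (gen G u)) := by
  simp [toSplitting, h]

theorem right_toSplitting (g : RAAG G) : (toSplitting G v g).right = toBase G v g := by
  have : rightHom.comp (toSplitting G v) = toBase G v := by
    refine hom_ext fun u => ?_
    by_cases h : u = v
    · subst h; simp [toSplitting_gen_self, toBase_gen_self]
    · simp [toSplitting_gen_of_ne h]
  exact DFunLike.congr_fun this g

theorem toSplitting_ret (g : RAAG G) :
    toSplitting G v (ret G {v}ᶜ g) = inr (toBase G v g) := by
  have : (toSplitting G v).comp (ret G {v}ᶜ) = inr.comp (toBase G v) := by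
    refine hom_ext fun u => ?_
    by_cases h : u = v
    · subst h; simp [ret_gen_of_notMem, toBase_gen_self]
    · have h' : u ∈ ({v}ᶜ : Set V) := h
      simp [ret_gen_of_mem h', toSplitting_gen_of_ne h]
  exact DFunLike.congr_fun this g

theorem toSplitting_coe (b : base G v) : toSplitting G v b = inr b := by
  obtain ⟨_, g, rfl⟩ := b
  exact toSplitting_ret g

/-- The conjugate of `v` corresponding to an edge. -/
def edgeConj (x : Edge G v) : RAAG G :=
  Quotient.liftOn' x (fun b => (b : RAAG G) * gen G v * (b : RAAG G)⁻¹) <| by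
    intro a b hab
    rw [QuotientGroup.leftRel_apply, Subgroup.mem_subgroupOf,
      Subgroup.mem_centralizer_singleton_iff] at hab
    simp only [Subgroup.coe_mul, Subgroup.coe_inv] at hab
    have : (b : RAAG G) * gen G v = a * gen G v * ((a : RAAG G)⁻¹ * b) := by
      rw [mul_assoc, ← hab]; group
    simp only [this]
    group

theorem edgeConj_mk (b : base G v) :
    edgeConj (b : Edge G v) = (b : RAAG G) * gen G v * (b : RAAG G)⁻¹ := rfl

/-- The inverse of `toSplitting`. -/
def ofSplitting (G : SimpleGraph V) (v : V) : Splitting G v →* RAAG G :=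
  SemidirectProduct.lift (FreeGroup.lift edgeConj) (base G v).subtype fun b => by
    refine FreeGroup.ext_hom _ _ fun x => ?_
    induction x using QuotientGroup.induction_on with
    | H c =>
      simp only [MonoidHom.comp_apply, MulEquiv.coe_toMonoidHom, basisAct_of,
        FreeGroup.lift_apply_of, MulAut.conj_apply, Subgroup.subtype_apply]
      rw [MulAction.Quotient.smul_coe, edgeConj_mk, edgeConj_mk]
      simp [mul_assoc]

theorem ofSplitting_toSplitting (g : RAAG G) : ofSplitting G v (toSplitting G v g) = g := by
  have : (ofSplitting G v).comp (toSplitting G v) = MonoidHom.id _ := by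
    refine hom_ext fun u => ?_
    by_cases h : u = v
    · subst h; simp [toSplitting_gen_self, ofSplitting, edgeConj_mk]
    · have h' : u ∈ ({v}ᶜ : Set V) := h
      simp [toSplitting_gen_of_ne h, ofSplitting, coe_toBase, ret_gen_of_mem h']
  exact DFunLike.congr_fun this g

theorem toSplitting_ofSplitting_inl (p : FreeGroup (Edge G v)) :
    toSplitting G v (ofSplitting G v (inl p)) = inl p := by
  have : ((toSplitting G v).comp (ofSplitting G v)).comp inl = inl := by
    refine FreeGroup.ext_hom _ _ fun x => ?_
    induction x using QuotientGroup.induction_on with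
    | H c =>
      have : (c : Edge G v) = c • ((1 : base G v) : Edge G v) := by
        rw [MulAction.Quotient.smul_coe]; simp
      simp only [MonoidHom.comp_apply, ofSplitting, lift_inl, FreeGroup.lift_apply_of, edgeConj_mk,
        map_mul, map_inv, toSplitting_coe, toSplitting_gen_self]
      rw [this, ← basisAct_of, inl_aut, map_inv]
  exact DFunLike.congr_fun this p

theorem move_toSplitting_one_iff {g : RAAG G} : move (toSplitting G v g) 1 = 1 ↔ g ∈ base G v := by
  constructor
  · intro h
    have h1 : toSplitting G v g = toSplitting G v (ret G {v}ᶜ g) := by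
      rw [toSplitting_ret]
      refine SemidirectProduct.ext ?_ ?_
      · simpa [move] using h
      · simp [right_toSplitting]
    exact mem_base.2 (by simpa [ofSplitting_toSplitting] using (congrArg (ofSplitting G v) h1).symm)
  · intro h
    rw [toSplitting_coe ⟨g, h⟩, move_inr_one]

theorem move_toSplitting_eq_iff {a g : RAAG G} :
    move (toSplitting G v g) (move (toSplitting G v a) 1) = move (toSplitting G v a) 1 ↔
      a⁻¹ * g * a ∈ base G v := by
  rw [← move_toSplitting_one_iff, map_mul, map_mul, map_inv, mul_assoc, move_mul, move_mul,
    move_inv_eq_iff]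

theorem exists_move_toSplitting_eq (p : FreeGroup (Edge G v)) :
    ∃ a : RAAG G, move (toSplitting G v a) 1 = p :=
  ⟨ofSplitting G v (inl p), by rw [toSplitting_ofSplitting_inl, move_inl_one]⟩

theorem ex_eq_zero_of_smul_eq {b : base G v} {x : Edge G v} (h : b • x = x) {u : V}
    (hu : u ∉ _root_.star G v) : ex u (b : RAAG G) = 0 := by
  induction x using QuotientGroup.induction_on with
  | H c =>
    rw [MulAction.Quotient.smul_coe, QuotientGroup.eq, Subgroup.mem_subgroupOf,
      Subgroup.mem_centralizer_singleton_iff] at h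
    have hu' := not_or.mp (mt mem_star_iff.mpr hu)
    have := ex_mul_ex_of_commute (i := u) (j := v) h fun h => hu'.2 h.symm
    simpa [ex_gen_of_ne (Ne.symm hu'.1)] using this

theorem ex_toBase {u : V} (hu : u ∉ _root_.star G v) (g : RAAG G) :
    ex u (toBase G v g : RAAG G) = ex u g :=
  ex_ret_of_mem (by intro h; exact hu (Or.inl h)) g

/-- An element with nonzero exponent off the star of `v` fixes at most one vertex of the
Bass-Serre tree of `v`. -/
theorem inv_mul_mem_base {g : RAAG G} {u : V} (hu : u ∉ _root_.star G v) (hg : ex u g ≠ 0)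
    {a c : RAAG G} (ha : a⁻¹ * g * a ∈ base G v) (hc : c⁻¹ * g * c ∈ base G v) :
    a⁻¹ * c ∈ base G v := by
  rw [← move_toSplitting_eq_iff] at ha hc
  rw [← move_toSplitting_one_iff, map_mul, map_inv, move_mul, move_inv_eq_iff]
  refine (move_fixed_unique (fun k x hx => ?_) ha hc).symm
  rw [right_toSplitting] at hx
  have := ex_eq_zero_of_smul_eq hx hu
  rw [Subgroup.coe_zpow, ex_zpow, ex_toBase hu] at this
  simpa [hg] using this

/-- An element `g` fixes a vertex of the Bass-Serre tree of `v` as soon as it commutes with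
an element `h` whose exponent off the star of `v` is not that of a power of `g`. -/
theorem exists_conj_mem_base {g h : RAAG G} (hgh : Commute g h) {u : V}
    (hu : u ∉ _root_.star G v) (hg : ex u g = 0) (hh : ex u h ≠ 0) :
    ∃ a : RAAG G, a⁻¹ * g * a ∈ base G v := by
  obtain ⟨p, hp⟩ := exists_move_fixed (hgh.map (toSplitting G v)) fun k i x hx => by
    rw [right_toSplitting, right_toSplitting] at hx
    have := ex_eq_zero_of_smul_eq hx hu
    simpa [ex_toBase hu, hg, hh] using this
  obtain ⟨a, rfl⟩ := exists_move_toSplitting_eq p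
  exact ⟨a, move_toSplitting_eq_iff.1 hp⟩

end Tree

section Inner

variable {V : Type} {G : SimpleGraph V} {v : V}

theorem exists_adj_notMem_star (hA : Austere G) {u : V} (h : u ≠ v) :
    ∃ x, G.Adj u x ∧ x ∉ _root_.star G v :=
  Set.not_subset.mp (hA.2.1 v u h.symm)

/-- If `ψ` acts trivially on the abelianization, then `ψ` maps the vertices other than `v` into a
common conjugate of `base G v`. -/
theorem exists_conj_map_mem_base (hA : Austere G) {ψ : RAAG G →* RAAG G}
    (hψ : ∀ w g, ex w (ψ g) = ex w g) (v : V) :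
    ∃ a, ∀ w, w ≠ v → a⁻¹ * ψ (gen G w) * a ∈ base G v := by
  obtain ⟨⟨u, hu⟩⟩ := (hA.2.2 v).nonempty
  obtain ⟨x, hx, hxv⟩ := exists_adj_notMem_star hA fun e : u = v => hu (Or.inl e)
  obtain ⟨a, ha⟩ := exists_conj_mem_base ((commute_gen hx).map ψ) hxv
    (by rw [hψ, ex_gen_of_ne hx.ne]) (by simp [hψ])
  have step : ∀ w w', w ∉ _root_.star G v → G.Adj w w' → a⁻¹ * ψ (gen G w) * a ∈ base G v →
      a⁻¹ * ψ (gen G w') * a ∈ base G v := by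
    intro w w' hw hww' h
    have hc : (ψ (gen G w') * a)⁻¹ * ψ (gen G w) * (ψ (gen G w') * a) =
        a⁻¹ * ψ (gen G w) * a := by
      have := ((commute_gen hww').map ψ).eq
      calc _ = a⁻¹ * (ψ (gen G w'))⁻¹ * (ψ (gen G w) * ψ (gen G w')) * a := by group
        _ = _ := by rw [this]; group
    simpa only [mul_assoc] using
      inv_mul_mem_base (g := ψ (gen G w)) hw (by simp [hψ]) h (hc ▸ h)
  have off : ∀ y : ↥(_root_.star G v)ᶜ, a⁻¹ * ψ (gen G y) * a ∈ base G v := by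
    intro y
    have := (SimpleGraph.reachable_iff_reflTransGen _ _).1 ((hA.2.2 v).preconnected ⟨u, hu⟩ y)
    induction this with
    | refl => exact ha
    | @tail y _ _ h ih => exact step _ _ y.2 (SimpleGraph.comap_adj.1 h) ih
  refine ⟨a, fun w hw => ?_⟩
  obtain ⟨y, hy, hyv⟩ := exists_adj_notMem_star hA hw
  exact step y w hyv hy.symm (off ⟨y, hyv⟩)

open Classical in
theorem exists_conj_map_mem_base_forall (hA : Austere G) (T : Finset V) {ψ : RAAG G →* RAAG G}
    (hψ : ∀ w g, ex w (ψ g) = ex w g) :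
    ∃ a, ∀ t ∈ T, ∀ w, w ≠ t → a⁻¹ * ψ (gen G w) * a ∈ base G t := by
  induction T using Finset.induction_on with
  | empty => exact ⟨1, by simp⟩
  | insert v T hv ih =>
    obtain ⟨b, hb⟩ := ih
    let χ : RAAG G →* RAAG G := (MulAut.conj b⁻¹).toMonoidHom.comp ψ
    have hχ : ∀ g, χ g = b⁻¹ * ψ g * b := fun g => by simp [χ]
    have hχex : ∀ w g, ex w (χ g) = ex w g := fun w g => by simp [hχ, hψ]
    simp only [← hχ] at hb
    obtain ⟨a, ha⟩ := exists_conj_map_mem_base hA hχex v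
    let S : V → Set V := fun u => (↑(T.erase u))ᶜ
    have hS : ∀ u, ret G (S u) (χ (gen G u)) = χ (gen G u) := fun u =>
      ret_compl_of_forall _ fun t ht =>
        mem_base.1 (hb t (Finset.mem_of_mem_erase ht) u (Finset.ne_of_mem_erase ht).symm)
    have hret : ∀ (R : Set V) (x : RAAG G), x ∈ base G v → ret G R x ∈ base G v := by
      intro R x hx
      rw [mem_base, ret_comm, mem_base.1 hx]
    have hcu : ∀ u, u ≠ v → (ret G (S u) a)⁻¹ * χ (gen G u) * ret G (S u) a ∈ base G v := by
      intro u hu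
      have := hret (S u) _ (ha u hu)
      rwa [map_mul, map_mul, map_inv, hS] at this
    have hac : ∀ u, u ∉ _root_.star G v → a⁻¹ * ret G (S u) a ∈ base G v := fun u hu =>
      have huv : u ≠ v := fun e => hu (Or.inl e)
      inv_mul_mem_base (g := χ (gen G u)) hu (by simp [hχex]) (ha u huv) (hcu u huv)
    obtain ⟨⟨u, hu⟩⟩ := (hA.2.2 v).nonempty
    obtain ⟨x, hx, hxv⟩ := exists_adj_notMem_star hA fun e : u = v => hu (Or.inl e)
    set c := ret G (↑T)ᶜ a with hc
    have hinter : S u ∩ S x = (↑T : Set V)ᶜ := by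
      have := hx.ne
      ext y
      simp only [S, Set.mem_inter_iff, Set.mem_compl_iff, Finset.mem_coe, Finset.mem_erase]
      grind
    have huc : a⁻¹ * c ∈ base G v := by
      have h := hret (S u) _ ((base G v).mul_mem ((base G v).inv_mem (hac u hu)) (hac x hxv))
      have h' : ret G (S u) ((a⁻¹ * ret G (S u) a)⁻¹ * (a⁻¹ * ret G (S x) a)) =
          (ret G (S u) a)⁻¹ * c := by
        simp only [map_mul, map_inv, ret_ret, Set.inter_self, hinter]
        rw [hc]; group
      rw [h'] at h
      have := (base G v).mul_mem (hac u hu) h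
      rwa [mul_assoc, mul_inv_cancel_left] at this
    refine ⟨b * c, fun t ht w hw => ?_⟩
    have hconj : (b * c)⁻¹ * ψ (gen G w) * (b * c) = c⁻¹ * χ (gen G w) * c := by
      rw [hχ]; group
    rw [hconj]
    rcases Finset.mem_insert.1 ht with rfl | ht
    · have := (base G t).mul_mem ((base G t).mul_mem ((base G t).inv_mem huc) (ha w hw)) huc
      convert this using 1
      group
    · have hct : c ∈ base G t := by
        rw [mem_base, hc, ret_ret, Set.inter_eq_self_of_subset_right]
        simpa using ht
      exact (base G t).mul_mem ((base G t).mul_mem ((base G t).inv_mem hct) (hb t ht w hw)) hct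

/-- An endomorphism acting trivially on the abelianization is inner. -/
theorem exists_eq_conj [Finite V] (hA : Austere G) {ψ : RAAG G →* RAAG G}
    (hψ : ∀ w g, ex w (ψ g) = ex w g) : ∃ a, ∀ g, ψ g = a * g * a⁻¹ := by
  classical
  have := Fintype.ofFinite V
  obtain ⟨a, ha⟩ := exists_conj_map_mem_base_forall hA Finset.univ hψ
  refine ⟨a, fun g => ?_⟩
  suffices ψ = (MulAut.conj a).toMonoidHom by rw [this]; simp
  refine hom_ext fun w => ?_
  have h : ret G (↑(Finset.univ.erase w))ᶜ (a⁻¹ * ψ (gen G w) * a) = a⁻¹ * ψ (gen G w) * a :=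
    ret_compl_of_forall _ fun t ht =>
      mem_base.1 (ha t (Finset.mem_univ t) w (Finset.ne_of_mem_erase ht).symm)
  have hw : (↑(Finset.univ.erase w) : Set V)ᶜ = {w} := by ext; simp
  rw [hw, ret_singleton] at h
  simp only [ex_mul, ex_inv, hψ, ex_gen_self] at h
  have h1 : gen G w = a⁻¹ * ψ (gen G w) * a := by rw [← h]; simp
  simp only [MulEquiv.coe_toMonoidHom, MulAut.conj_apply]
  nth_rw 2 [h1]
  group

theorem center_eq_bot [Finite V] (hA : Austere G) : Subgroup.center (RAAG G) = ⊥ := by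
  have := Fintype.ofFinite V
  refine (Subgroup.eq_bot_iff_forall _).2 fun a ha => ?_
  rw [← ret_empty (G := G) a, ← Set.compl_univ, ← Finset.coe_univ]
  refine (ret_compl_of_forall _ fun v _ => ?_).symm
  obtain ⟨⟨u, hu⟩⟩ := (hA.2.2 v).nonempty
  have huv : u ≠ v := fun e => hu (Or.inl e)
  have hg : gen G u ∈ base G v := mem_base.2 (ret_gen_of_mem (by simpa using huv))
  have := inv_mul_mem_base (g := gen G u) (a := 1) (c := a) hu (by simp) (by simpa using hg)
    (by rwa [mul_assoc, Subgroup.mem_center_iff.1 ha (gen G u), inv_mul_cancel_left])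
  exact mem_base.1 (by simpa using this)

end Inner

section Diagonal

variable {V : Type} {G : SimpleGraph V}

open Matrix

theorem mul_mulVec_eq [Fintype V] {M : Matrix V V ℚ}
    (hM : ∀ u v i j, G.Adj u v → ¬G.Adj i j → M i u * M j v = M j u * M i v) {v : V} {z : V → ℚ}
    (hz : ∀ u, u ∉ _root_.star G v → z u = 0) {i j : V} (hij : ¬G.Adj i j) :
    M i v * (M *ᵥ z) j = M j v * (M *ᵥ z) i := by
  simp only [mulVec, dotProduct, Finset.mul_sum]
  refine Finset.sum_congr rfl fun u _ => ?_
  by_cases hu : u ∈ _root_.star G v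
  · rcases mem_star_iff.1 hu with rfl | hu
    · ring
    · linear_combination z u * hM v u i j hu hij
  · simp [hz u hu]

/-- The map sending a vector supported on the star of `v` to the restriction of its image
under `M` to the star of `w`. -/
def starMap [Fintype V] (G : SimpleGraph V) (M : Matrix V V ℚ) (v w : V) :
    (_root_.star G v → ℚ) →ₗ[ℚ] (_root_.star G w → ℚ) :=
  LinearMap.funLeft ℚ ℚ Subtype.val ∘ₗ M.mulVecLin ∘ₗ
    Function.ExtendByZero.linearMap ℚ Subtype.val

theorem starMap_apply [Fintype V] (M : Matrix V V ℚ) (v w : V) (c : _root_.star G v → ℚ)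
    (i : _root_.star G w) :
    starMap G M v w c i = (M *ᵥ Function.extend Subtype.val c 0) i := rfl

theorem extend_eq_zero {v u : V} (c : _root_.star G v → ℚ) (hu : u ∉ _root_.star G v) :
    Function.extend Subtype.val c 0 u = 0 :=
  Function.extend_apply' _ _ _ fun ⟨a, ha⟩ => hu (ha ▸ a.2)

theorem starMap_injective [Fintype V] [DecidableEq V] {M : Matrix V V ℚ} (hdet : M.det ≠ 0)
    (hM : ∀ u v i j, G.Adj u v → ¬G.Adj i j → M i u * M j v = M j u * M i v) {v w : V}
    (hw : M w v ≠ 0) : Function.Injective (starMap G M v w) := by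
  refine (injective_iff_map_eq_zero _).2 fun c hc => ?_
  have hy : ∀ j ∈ _root_.star G w, (M *ᵥ Function.extend Subtype.val c 0) j = 0 := fun j hj =>
    congrFun hc ⟨j, hj⟩
  have h0 : Function.extend Subtype.val c 0 = 0 := by
    refine eq_zero_of_mulVec_eq_zero hdet (funext fun j => ?_)
    by_cases hj : j ∈ _root_.star G w
    · exact hy j hj
    · have := mul_mulVec_eq hM (fun u hu => extend_eq_zero c hu) fun h => hj (Or.inr h)
      rw [hy w (Or.inl rfl), mul_zero] at this
      exact (mul_eq_zero.1 this).resolve_left hw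
  funext u
  simpa [Subtype.val_injective.extend_apply] using congrFun h0 u

theorem exists_perm_ne_zero {n R : Type*} [Fintype n] [DecidableEq n] [CommRing R]
    [IsDomain R] {M : Matrix n n R} (hdet : M.det ≠ 0) :
    ∃ σ : Equiv.Perm n, ∀ v, M (σ v) v ≠ 0 := by
  rw [det_apply'] at hdet
  obtain ⟨σ, -, hσ⟩ := Finset.exists_ne_zero_of_sum_ne_zero hdet
  exact ⟨σ, fun v => Finset.prod_ne_zero_iff.1 (right_ne_zero_of_mul hσ) v (Finset.mem_univ v)⟩

/-- A nonsingular matrix preserving commutation relations, over a graph without domination,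
is monomial. -/
theorem eq_zero_of_ne_perm [Fintype V] [DecidableEq V] (hG : ∀ u v : V, u ≠ v → ¬Dominates G u v)
    {M : Matrix V V ℚ} (hdet : M.det ≠ 0)
    (hM : ∀ u v i j, G.Adj u v → ¬G.Adj i j → M i u * M j v = M j u * M i v)
    {σ : Equiv.Perm V} (hσ : ∀ v, M (σ v) v ≠ 0) {v j : V} (hj : j ≠ σ v) : M j v = 0 := by
  classical
  have hinj := fun v => starMap_injective hdet hM (hσ v)
  have hle : ∀ v ∈ Finset.univ,
      Fintype.card (_root_.star G v) ≤ Fintype.card (_root_.star G (σ v)) := fun v _ => by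
    simpa using LinearMap.finrank_le_finrank_of_injective (hinj v)
  have heq := (Finset.sum_eq_sum_iff_of_le hle).1
    (Equiv.sum_comp σ fun v => Fintype.card (_root_.star G v)).symm
  have hsurj : Function.Surjective (starMap G M v (σ v)) :=
    (LinearMap.injective_iff_surjective_of_finrank_eq_finrank
      (by simpa using heq v (Finset.mem_univ v))).1 (hinj v)
  obtain ⟨u, hu, huj⟩ := Set.not_subset.1 (hG j (σ v) hj)
  have huw : u ∈ _root_.star G (σ v) := Or.inr hu
  obtain ⟨c, hc⟩ := hsurj (Pi.single ⟨u, huw⟩ 1)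
  set y := M *ᵥ Function.extend Subtype.val c 0 with hy
  have hyi : ∀ i (hi : i ∈ _root_.star G (σ v)), y i = if i = u then 1 else 0 := by
    intro i hi
    have := congrFun hc ⟨i, hi⟩
    rw [starMap_apply] at this
    simpa [Pi.single_apply] using this
  have hmul := fun {i k : V} => mul_mulVec_eq (i := i) (j := k) hM (fun u hu => extend_eq_zero c hu)
  have hyj : y j = 0 := by
    by_cases hjw : j ∈ _root_.star G (σ v)
    · rw [hyi j hjw, if_neg fun e => huj (Or.inl e.symm)]
    · have := hmul fun h => hjw (Or.inr h)
      rw [← hy, hyi (σ v) (Or.inl rfl), if_neg (G.ne_of_adj hu), mul_zero] at this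
      exact (mul_eq_zero.1 this).resolve_left (hσ v)
  have := hmul (i := j) (k := u) fun h => huj (Or.inr h)
  rw [← hy, hyj, hyi u huw, if_pos rfl, mul_zero, mul_one] at this
  exact this

theorem adj_of_adj_perm [Finite V] {σ : Equiv.Perm V}
    (hσ : ∀ u v, G.Adj u v → G.Adj (σ u) (σ v)) {u v : V} (h : G.Adj (σ u) (σ v)) : G.Adj u v := by
  have hpow : ∀ (k : ℕ) u v, G.Adj u v → G.Adj ((σ ^ k) u) ((σ ^ k) v) := by
    intro k
    induction k with
    | zero => simp
    | succ k ih =>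
      intro u v h
      simpa [pow_succ] using ih _ _ (hσ u v h)
  have h1 : σ ^ (orderOf σ - 1) * σ = 1 := by
    rw [← pow_succ, Nat.sub_add_cancel (orderOf_pos σ), pow_orderOf_eq_one]
  have h2 : ∀ x, (σ ^ (orderOf σ - 1)) (σ x) = x := fun x => congrArg (fun f => f x) h1
  simpa [h2] using hpow (orderOf σ - 1) _ _ h

/-- Over an austere graph, a nonsingular matrix preserving commutation relations is diagonal. -/
theorem eq_zero_of_ne [Fintype V] [DecidableEq V] (hA : Austere G)
    {M : Matrix V V ℚ} (hdet : M.det ≠ 0)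
    (hM : ∀ u v i j, G.Adj u v → ¬G.Adj i j → M i u * M j v = M j u * M i v)
    {v j : V} (hj : j ≠ v) : M j v = 0 := by
  obtain ⟨σ, hσ⟩ := exists_perm_ne_zero hdet
  have h0 : ∀ {v j : V}, j ≠ σ v → M j v = 0 := eq_zero_of_ne_perm hA.2.1 hdet hM hσ
  have hadj : ∀ u v, G.Adj u v → G.Adj (σ u) (σ v) := by
    intro u v huv
    by_contra h
    have := hM u v _ _ huv h
    rw [h0 (j := σ v) (v := u) (σ.injective.ne huv.ne'), zero_mul] at this
    exact mul_ne_zero (hσ u) (hσ v) this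
  have hσv : σ v = v := hA.1 ⟨σ, fun {u v} => ⟨adj_of_adj_perm hadj, hadj u v⟩⟩ v
  exact h0 (by rwa [hσv])

theorem ex_map [Fintype V] (ψ : RAAG G →* RAAG G) (w : V) (g : RAAG G) :
    ex w (ψ g) = ∑ u, ex w (ψ (gen G u)) * ex u g := by
  classical
  have : (exHom G w).comp ψ = ∏ u, (zpowersHom _ (exHom G w (ψ (gen G u)))).comp (exHom G u) := by
    refine hom_ext fun v => ?_
    simp only [MonoidHom.comp_apply, MonoidHom.finsetProd_apply]
    rw [Finset.prod_eq_single v]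
    · simp [exHom]
    · intro u _ hu
      simp [exHom, hu.symm]
    · simp
  have h := congrArg Multiplicative.toAdd (DFunLike.congr_fun this g)
  simp only [MonoidHom.comp_apply, MonoidHom.finsetProd_apply, toAdd_prod] at h
  rw [ex, h]
  refine Finset.sum_congr rfl fun u _ => ?_
  simp [ex, mul_comm]

/-- An automorphism acts on the abelianization by a diagonal matrix. -/
theorem ex_map_gen_of_ne [Finite V] (hA : Austere G) (ψ : MulAut (RAAG G)) {w v : V} (h : w ≠ v) :
    ex w (ψ (gen G v)) = 0 := by
  classical
  have := Fintype.ofFinite V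
  let M : MulAut (RAAG G) → Matrix V V ℚ := fun χ i j => (ex i (χ (gen G j)) : ℚ)
  have hM : M ψ * M ψ⁻¹ = 1 := by
    ext i j
    have := ex_map ψ.toMonoidHom i (ψ⁻¹ (gen G j))
    simp only [MulEquiv.coe_toMonoidHom, MulAut.apply_inv_self] at this
    rw [Matrix.mul_apply, Matrix.one_apply]
    simp only [M]
    rw [ex_gen] at this
    simp only [eq_comm (a := i)]
    exact_mod_cast this.symm
  have hdet : (M ψ).det ≠ 0 := fun h0 => by
    simpa [h0] using congrArg Matrix.det hM
  have := eq_zero_of_ne hA hdet (fun u v i j huv hij => by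
    have := ex_mul_ex_of_commute ((commute_gen huv).map ψ) hij
    simp only [M]
    exact_mod_cast this) h
  simpa [M] using this

theorem isUnit_ex_map_gen [Finite V] (hA : Austere G) (ψ : MulAut (RAAG G)) (v : V) :
    IsUnit (ex v (ψ (gen G v))) := by
  classical
  have := Fintype.ofFinite V
  have := ex_map ψ.toMonoidHom v (ψ⁻¹ (gen G v))
  simp only [MulEquiv.coe_toMonoidHom, MulAut.apply_inv_self, ex_gen_self] at this
  rw [Finset.sum_eq_single v (fun u _ hu => by rw [ex_map_gen_of_ne hA ψ hu.symm, zero_mul])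
    (by simp)] at this
  exact IsUnit.of_mul_eq_one _ this.symm

end Diagonal

section Shift

open SemidirectProduct

variable {V : Type} {G : SimpleGraph V}

/-- The endomorphism raising each generator to a given sign. -/
def signHom (G : SimpleGraph V) (e : V → ℤˣ) : RAAG G →* RAAG G :=
  lift (fun v => gen G v ^ (e v : ℤ)) fun _ _ h => (commute_gen h).zpow_zpow _ _

theorem signHom_gen (e : V → ℤˣ) (v : V) : signHom G e (gen G v) = gen G v ^ (e v : ℤ) :=
  lift_gen _ _ v

theorem signHom_mul (e f : V → ℤˣ) : signHom G (e * f) = (signHom G e).comp (signHom G f) :=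
  hom_ext fun v => by simp [signHom_gen, zpow_mul]

theorem signHom_comp_self (e : V → ℤˣ) : (signHom G e).comp (signHom G e) = MonoidHom.id _ := by
  rw [← signHom_mul]
  exact hom_ext fun v => by simp [signHom_gen]

/-- The action of sign vectors on a right-angled Artin group by inversions. -/
def signAut (G : SimpleGraph V) : (V → ℤˣ) →* MulAut (RAAG G) where
  toFun e := (signHom G e).toMulEquiv (signHom G e) (signHom_comp_self e) (signHom_comp_self e)
  map_one' := by
    refine MulEquiv.toMonoidHom_injective (hom_ext fun v => ?_)
    change signHom G 1 (gen G v) = gen G v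
    simp [signHom_gen]
  map_mul' e f := MulEquiv.toMonoidHom_injective (signHom_mul e f)

theorem signAut_gen (e : V → ℤˣ) (v : V) : signAut G e (gen G v) = gen G v ^ (e v : ℤ) :=
  signHom_gen e v

/-- The semidirect product of a right-angled Artin group with its group of inversions. -/
abbrev SignProd (G : SimpleGraph V) := RAAG G ⋊[signAut G] (V → ℤˣ)

/-- The homomorphism to the automorphism group. -/
def toAut (G : SimpleGraph V) : SignProd G →* MulAut (RAAG G) :=
  SemidirectProduct.lift MulAut.conj (signAut G) fun e => by
    ext a x
    simp

theorem toAut_apply (p : SignProd G) (x : RAAG G) :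
    toAut G p x = p.left * signAut G p.right x * p.left⁻¹ := rfl

theorem toAut_injective [Finite V] (hA : Austere G) : Function.Injective (toAut G) := by
  refine (injective_iff_map_eq_one _).2 fun p hp => ?_
  have h : ∀ x, p.left * signAut G p.right x * p.left⁻¹ = x := fun x => by
    rw [← toAut_apply, hp, MulAut.one_apply]
  have hr : p.right = 1 := funext fun v => Units.ext <| by
    simpa [signAut_gen] using congrArg (ex v) (h (gen G v))
  have hl : p.left ∈ Subgroup.center (RAAG G) := Subgroup.mem_center_iff.2 fun x => by
    have := h x
    rw [hr, map_one, MulAut.one_apply, mul_inv_eq_iff_eq_mul] at this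
    exact this.symm
  rw [center_eq_bot hA, Subgroup.mem_bot] at hl
  exact SemidirectProduct.ext hl hr

theorem toAut_surjective [Finite V] (hA : Austere G) : Function.Surjective (toAut G) := by
  intro ψ
  choose e he using isUnit_ex_map_gen hA ψ
  have := Fintype.ofFinite V
  obtain ⟨a, ha⟩ := exists_eq_conj hA (ψ := (ψ * signAut G e).toMonoidHom) fun w g => by
    rw [ex_map, Finset.sum_eq_single w]
    · simp [signAut_gen, ← he, ← Units.val_mul]
    · intro u _ hu
      simp [signAut_gen, ex_map_gen_of_ne hA ψ hu.symm]
    · simp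
  refine ⟨⟨a, e⟩, MulEquiv.ext fun x => ?_⟩
  rw [toAut_apply, ← ha]
  change ψ (signAut G e (signAut G e x)) = ψ x
  exact congrArg ψ (DFunLike.congr_fun (signHom_comp_self e) x)

/-- The automorphism group of the right-angled Artin group of an austere graph. -/
def autEquiv [Finite V] (hA : Austere G) : SignProd G ≃* MulAut (RAAG G) :=
  MulEquiv.ofBijective (toAut G) ⟨toAut_injective hA, toAut_surjective hA⟩

/-- The families of sign vectors, indexed by the vertices, that are trivial on stars. -/
abbrev Shift (G : SimpleGraph V) :=
  {s : V → V → ℤˣ // ∀ v, ∀ w ∈ _root_.star G v, s v w = 1}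

theorem commute_inl_gen_inr (s : Shift G) {v w : V} (h : w ∈ _root_.star G v) :
    Commute (inl (gen G w) : SignProd G) (inr (s.1 v)) :=
  commute_inl_inr (by simp [signAut_gen, s.2 v w h])

/-- The endomorphism multiplying each generator by the corresponding sign vector. -/
def shiftHom (s : Shift G) : SignProd G →* SignProd G :=
  SemidirectProduct.lift
    (RAAG.lift (fun v => inl (gen G v) * inr (s.1 v)) fun u v h => by
      have huv := commute_inl_gen_inr s (Or.inr h : v ∈ _root_.star G u)
      have hvu := commute_inl_gen_inr s (Or.inr h.symm : u ∈ _root_.star G v)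
      have hr : Commute (inr (s.1 u) : SignProd G) (inr (s.1 v)) := (Commute.all _ _).map inr
      exact (((commute_gen h).map inl).mul_right hvu).mul_left (huv.symm.mul_right hr))
    inr fun e => by
      refine hom_ext fun v => ?_
      simp only [MonoidHom.comp_apply, MulEquiv.coe_toMonoidHom, signAut_gen, map_zpow, lift_gen,
        MulAut.conj_apply]
      rw [(commute_inl_gen_inr s (Or.inl rfl)).mul_zpow, ← map_zpow, ← map_zpow, ← signAut_gen,
        inl_aut]
      have : s.1 v ^ (e v : ℤ) = s.1 v := by
        rcases Int.units_eq_one_or (e v) with h | h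
        · simp [h]
        · simp only [h, Units.val_neg, Units.val_one, zpow_neg, zpow_one]
          exact funext fun w => Int.units_inv_eq_self _
      rw [this, ← map_inv]
      simp only [mul_assoc, ← map_mul, mul_comm]

theorem shiftHom_inl_gen (s : Shift G) (v : V) :
    shiftHom s (inl (gen G v)) = inl (gen G v) * inr (s.1 v) := by
  simp [shiftHom]

theorem shiftHom_inr (s : Shift G) (e : V → ℤˣ) : shiftHom s (inr e) = inr e := by
  simp [shiftHom]

theorem shiftHom_comp_self (s : Shift G) :
    (shiftHom s).comp (shiftHom s) = MonoidHom.id _ := by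
  refine SemidirectProduct.hom_ext (RAAG.hom_ext fun v => ?_) (MonoidHom.ext fun e => ?_)
  · have : s.1 v * s.1 v = 1 := funext fun w => Int.units_mul_self _
    simp only [MonoidHom.comp_apply, shiftHom_inl_gen, map_mul, shiftHom_inr, mul_assoc]
    simp [← map_mul, this]
  · simp [shiftHom_inr]

/-- The automorphism multiplying each generator by the corresponding sign vector. -/
def shiftAut (s : Shift G) : MulAut (SignProd G) :=
  (shiftHom s).toMulEquiv (shiftHom s) (shiftHom_comp_self s) (shiftHom_comp_self s)

theorem right_shiftAut_inl_gen (s : Shift G) (v : V) :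
    rightHom (shiftAut s (inl (gen G v))) = s.1 v := by
  change rightHom (shiftHom s (inl (gen G v))) = s.1 v
  simp [shiftHom_inl_gen]

/-- The outer automorphism of the automorphism group determined by a family of sign vectors. -/
def shiftOut [Finite V] (hA : Austere G) (s : Shift G) : Out (MulAut (RAAG G)) :=
  QuotientGroup.mk (MulAut.congr (autEquiv hA) (shiftAut s))

theorem shiftOut_injective [Finite V] (hA : Austere G) : Function.Injective (shiftOut hA) := by
  intro s t h
  obtain ⟨y, hy⟩ := QuotientGroup.eq.1 h
  rw [eq_inv_mul_iff_mul_eq] at hy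
  refine Subtype.ext (funext fun v => ?_)
  have hv := DFunLike.congr_fun hy (autEquiv hA (inl (gen G v)))
  have hv' : shiftAut s ((autEquiv hA).symm y * inl (gen G v) * ((autEquiv hA).symm y)⁻¹) =
      shiftAut t (inl (gen G v)) := by
    exact (autEquiv hA).injective (by simpa [MulAut.congr] using hv)
  have := congrArg rightHom hv'
  rwa [map_mul, map_mul, map_inv, map_mul, map_mul, map_inv, mul_right_comm, mul_inv_cancel,
    one_mul, right_shiftAut_inl_gen, right_shiftAut_inl_gen] at this

open Classical in
/-- The shift determined by its signs off the stars. -/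
def mkShift (f : (Σ v, ↥(_root_.star G v)ᶜ) → ℤˣ) : Shift G :=
  ⟨fun v w => if h : w ∈ _root_.star G v then 1 else f ⟨v, w, h⟩, fun v w h => by simp [h]⟩

theorem mkShift_injective : Function.Injective (mkShift (G := G)) := by
  rintro f g h
  funext ⟨v, w, hw⟩
  have hw' : w ∉ _root_.star G v := hw
  simpa [mkShift, hw'] using congrFun (congrFun (congrArg Subtype.val h) v) w

theorem le_card_sigma_compl_star [Finite V] {d : ℕ}
    (hd : ∀ v : V, Nat.card (G.neighborSet v) ≤ d) :
    Nat.card V * (Nat.card V - d - 1) ≤ Nat.card (Σ v, ↥(_root_.star G v)ᶜ) := by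
  have := Fintype.ofFinite V
  rw [Nat.card_sigma, Nat.card_eq_fintype_card, ← smul_eq_mul, ← Finset.card_univ]
  refine Finset.card_nsmul_le_sum _ _ _ fun v _ => ?_
  have h1 := Set.ncard_add_ncard_compl (_root_.star G v)
  have h2 := Set.ncard_insert_le v (G.neighborSet v)
  have h3 := hd v
  rw [Nat.card_coe_set_eq] at h3 ⊢
  rw [Nat.card_eq_fintype_card, ← Finset.card_univ] at h1
  unfold _root_.star at *
  omega

theorem two_pow_le_mk_out [Finite V] (hA : Austere G) {d : ℕ}
    (hd : ∀ v : V, Nat.card (G.neighborSet v) ≤ d) :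
    (2 : Cardinal) ^ (Nat.card V * (Nat.card V - d - 1)) ≤
      Cardinal.mk (Out (MulAut (RAAG G))) := by
  refine le_trans ?_ (Cardinal.mk_le_of_injective
    ((shiftOut_injective hA).comp mkShift_injective))
  have h : 2 ^ (Nat.card V * (Nat.card V - d - 1)) ≤
      Nat.card ((Σ v, ↥(_root_.star G v)ᶜ) → ℤˣ) := by
    rw [Nat.card_fun, Nat.card_eq_fintype_card (α := ℤˣ), Fintype.card_units_int]
    exact Nat.pow_le_pow_right two_pos (le_card_sigma_compl_star hd)
  rw [← Nat.cast_card]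
  exact_mod_cast h

end Shift

end RAAG

/-- If `Γ` is austere with `n > 1` vertices of maximal valence at most `d`, then
`|Out(Aut(A_Γ))| ≥ 2^{n(n-d-1)}`. -/
theorem stmt16 {V : Type} [Fintype V] (G : SimpleGraph V) (hA : Austere G)
    (hn : 1 < Nat.card V) (d : ℕ)
    (hd : ∀ v : V, Nat.card (G.neighborSet v) ≤ d)
    (hnd : d + 1 ≤ Nat.card V) :
    (2 : Cardinal) ^ (Nat.card V * (Nat.card V - d - 1)) ≤
      Cardinal.mk (Out (MulAut (RAAG G))) :=
  RAAG.two_pow_le_mk_out hA hd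
end
end
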